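/- Let n > 6, write n = 2^t + m with 0 ≤ m < 2^t, and let k, ℓ ∈ ℕ with k < ℓ < t and 2^k ≤ m. Write n = 2^{a_1} + ⋯ + 2^{a_r} with a_1 > ⋯ > a_r ≥ 0, let p, q ∈ {1,…,r} be maximal with a_p ≥ ℓ and a_q ≥ k respectively, set b_j = a_j − k for 1 ≤ j ≤ q and I = {1,…,q}. If a_p > a_q, or a_p = a_q > ℓ, then F_{k,ℓ}(n) = (∏_{j=q+1}^{r} 2^{a_j}) · 2^k · ∑_{{p,q} ⊆ J ⊆ I} w_F(J). If a_p = a_q = ℓ, then F_{k,ℓ}(n) = (∏_{j=q+1}^{r} 2^{a_j}) · ( 2^k · ∑_{{p−1,p} ⊆ J ⊆ I} w_F(J) + 2^{k(q−1)} (2^k − 1) ∏_{i ∈ I} 2^{b_i} ). -/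

import Mathlib

namespace OddSym

open scoped Classical

/-- Remove one box from a row of size `p` (as multisets of parts). -/
def removeBox (lam : Multiset ℕ) (p : ℕ) : Multiset ℕ :=
  if p ≤ 1 then lam.erase p else (p - 1) ::ₘ lam.erase p

lemma removeBox_sum_lt {lam : Multiset ℕ} {p : ℕ} (hp : p ∈ lam) (h0 : 0 < p) :
    (removeBox lam p).sum < lam.sum := by
  have h : p + (lam.erase p).sum = lam.sum := by
    conv_rhs => rw [← Multiset.cons_erase hp]
    simp [Multiset.sum_cons]
  unfold removeBox
  split
  · omega
  · simp only [Multiset.sum_cons]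
    omega

/-- The number of standard Young tableaux of shape `lam`
(equivalently, the degree of the irreducible character of the symmetric
group labelled by `lam`), defined via the branching rule. -/
def degSYT (lam : Multiset ℕ) : ℕ :=
  if _h : lam = 0 then 1
  else ∑ p ∈ (lam.toFinset.filter (fun p => 0 < p)).attach, degSYT (removeBox lam p.1)
termination_by lam.sum
decreasing_by
  have hp := p.2
  simp only [Finset.mem_filter, Multiset.mem_toFinset] at hp
  exact removeBox_sum_lt hp.1 hp.2

/-- `lam` is an odd partition: all parts positive and the number of standard
Young tableaux of shape `lam` (= the character degree) is odd. -/
def OddP (lam : Multiset ℕ) : Prop :=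
  (∀ x ∈ lam, 0 < x) ∧ Odd (degSYT lam)

/-- The parts of `lam` sorted in weakly decreasing order. -/
def descList (lam : Multiset ℕ) : List ℕ :=
  (lam.sort (· ≤ ·)).reverse

/-- The beta-set (set of beta-numbers) of `lam` with `m` beads:
`{ lam_i + (m - i) : 1 ≤ i ≤ m }` where `lam` is padded with zero parts. -/
def betaSet (lam : Multiset ℕ) (m : ℕ) : Finset ℕ :=
  (Finset.range m).image (fun i => (descList lam).getD i 0 + (m - 1 - i))

/-- `mu` is obtained from `lam` by removing an `e`-hook: in some beta-set of
`lam` a beta-number `x` is replaced by `x - e` (which is not a beta-number). -/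
def IsHookRemoval (e : ℕ) (lam mu : Multiset ℕ) : Prop :=
  (∀ x ∈ lam, 0 < x) ∧ (∀ x ∈ mu, 0 < x) ∧ 0 < e ∧
  ∃ m x, Multiset.card lam ≤ m ∧ Multiset.card mu ≤ m ∧
    x ∈ betaSet lam m ∧ e ≤ x ∧ x - e ∉ betaSet lam m ∧
    betaSet mu m = insert (x - e) ((betaSet lam m).erase x)

/-- The map `f_k` : for an odd partition `lam` with `2^k ≤ |lam|`, the unique
odd partition obtained from `lam` by removing a `2^k`-hook (junk value `0` if
no such partition exists). -/
noncomputable def fkOp (k : ℕ) (lam : Multiset ℕ) : Multiset ℕ :=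
  if h : ∃ mu, IsHookRemoval (2 ^ k) lam mu ∧ OddP mu then h.choose else 0

/-- The partition encoded by a finite beta-set: each bead contributes a part
equal to the number of gaps below it. -/
def partOfBeta (S : Finset ℕ) : Multiset ℕ :=
  (S.val.map (fun b => b - (S.filter (fun a => a < b)).card)).filter (fun p => 0 < p)

/-- The 2-quotient `(lam_0, lam_1)` of `lam`, computed from a beta-set with an
even number of beads via the two runners of the 2-abacus. -/
def quot2 (lam : Multiset ℕ) : Multiset ℕ × Multiset ℕ :=
  (partOfBeta (((betaSet lam (2 * Multiset.card lam)).filter (fun b => b % 2 = 0)).image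
      (fun b => b / 2)),
   partOfBeta (((betaSet lam (2 * Multiset.card lam)).filter (fun b => b % 2 = 1)).image
      (fun b => b / 2)))

/-- The `e`-core of `lam`: push all beads of an `e`-abacus configuration for
`lam` up as far as possible. -/
def coreP (e : ℕ) (lam : Multiset ℕ) : Multiset ℕ :=
  partOfBeta ((Finset.range (e * (Multiset.card lam + e))).filter
    (fun x => x / e <
      ((betaSet lam (Multiset.card lam + e)).filter (fun b => b % e = x % e)).card))

/-- Row `k` of the 2-quotient tower of `lam`: row 0 is `[lam]`, and row `k+1`
replaces each entry of row `k` by its 2-quotient pair. -/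
def towerRow : ℕ → Multiset ℕ → List (Multiset ℕ)
  | 0, lam => [lam]
  | (k + 1), lam => (towerRow k lam).flatMap (fun mu => [(quot2 mu).1, (quot2 mu).2])

/-- `R_k^j(lam)`: the component of row `k` of the 2-quotient tower of `lam`
from which a `2^(j-k)`-hook is removed in the passage from `lam` to `f_j(lam)`;
it is characterized by: row `k` for `f_j(lam)` is obtained from row `k` for
`lam` by replacing this component by its image under `f_(j-k)`. -/
noncomputable def Rcomp (k j : ℕ) (lam : Multiset ℕ) : Multiset ℕ :=
  if h : ∃ s, s < 2 ^ k ∧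
      towerRow k (fkOp j lam) =
        (towerRow k lam).set s (fkOp (j - k) ((towerRow k lam).getD s 0))
  then (towerRow k lam).getD h.choose 0 else 0


/-- `F_(k,l)(n)`, the number of odd partitions of `n` on which `f_k` and `f_l`
do not commute. -/
noncomputable def Fnum (k l n : ℕ) : ℕ :=
  {lam : Multiset ℕ | OddP lam ∧ lam.sum = n ∧
    fkOp k (fkOp l lam) ≠ fkOp l (fkOp k lam)}.ncard

/-- The number of gaps of the bead set `X` below position `b`. -/
def gap (X : Finset ℕ) (b : ℕ) : ℕ := b - (X.filter (fun a => a < b)).card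

/-- The size of the partition encoded by the bead set `X`. -/
def sz (X : Finset ℕ) : ℕ := ∑ b ∈ X, gap X b

/-- The number of standard tableaux of the partition encoded by `X` is odd. -/
def OddB (X : Finset ℕ) : Prop := Odd (degSYT (partOfBeta X))

/-- The beads of `X` that can be moved down by `e` positions. -/
def movable (e : ℕ) (X : Finset ℕ) : Finset ℕ := X.filter (fun x => e ≤ x ∧ x - e ∉ X)

/-- Move the bead `x` down by `e` positions. -/
def move (e : ℕ) (X : Finset ℕ) (x : ℕ) : Finset ℕ := insert (x - e) (X.erase x)

/-- `Y` arises from `X` by moving one bead down by `e` positions. -/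
def IsChild (e : ℕ) (X Y : Finset ℕ) : Prop := ∃ x ∈ movable e X, Y = move e X x

lemma mem_movable {e x : ℕ} {X : Finset ℕ} :
    x ∈ movable e X ↔ x ∈ X ∧ e ≤ x ∧ x - e ∉ X := by
  simp [movable]

lemma mem_move {e x y : ℕ} {X : Finset ℕ} :
    y ∈ move e X x ↔ y = x - e ∨ (y ≠ x ∧ y ∈ X) := by
  simp [move]

lemma card_filter_lt_le (X : Finset ℕ) (b : ℕ) : (X.filter (fun a => a < b)).card ≤ b := by
  calc _ ≤ (Finset.range b).card := Finset.card_le_card (by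
        intro a; simp)
    _ = b := by simp

lemma sum_card_filter_lt (X : Finset ℕ) :
    ∑ b ∈ X, (X.filter (fun a => a < b)).card = ∑ i ∈ Finset.range X.card, i := by
  induction X using Finset.induction_on_max with
  | empty => simp
  | insert m s hm ih =>
    have hms : m ∉ s := fun h => lt_irrefl _ (hm m h)
    rw [Finset.sum_insert hms, Finset.card_insert_of_notMem hms, Finset.sum_range_succ, ← ih,
      add_comm]
    congr 1
    · refine Finset.sum_congr rfl fun b hb => ?_
      rw [Finset.filter_insert, if_neg (not_lt.2 (hm b hb).le)]
    · rw [Finset.filter_insert, if_neg (lt_irrefl m), Finset.filter_true_of_mem hm]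

lemma sum_eq_sz_add (X : Finset ℕ) :
    ∑ x ∈ X, x = sz X + ∑ i ∈ Finset.range X.card, i := by
  rw [← sum_card_filter_lt, sz, ← Finset.sum_add_distrib]
  refine Finset.sum_congr rfl fun b _ => ?_
  have := card_filter_lt_le X b
  unfold gap; omega

lemma card_move {e x : ℕ} {X : Finset ℕ} (h : x ∈ movable e X) :
    (move e X x).card = X.card := by
  rw [mem_movable] at h
  rw [move, Finset.card_insert_of_notMem (by simp [h.2.2]), Finset.card_erase_add_one h.1]

lemma sz_move {e x : ℕ} {X : Finset ℕ} (h : x ∈ movable e X) :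
    sz (move e X x) + e = sz X := by
  have h1 := sum_eq_sz_add X
  have h2 := sum_eq_sz_add (move e X x)
  rw [card_move h] at h2
  rw [mem_movable] at h
  rw [move, Finset.sum_insert (by simp [h.2.2])] at h2
  rw [← Finset.add_sum_erase _ _ h.1] at h1
  rw [← move] at h2
  omega

lemma IsChild.card_eq {e : ℕ} {X Y : Finset ℕ} (h : IsChild e X Y) : Y.card = X.card := by
  obtain ⟨x, hx, rfl⟩ := h; exact card_move hx

lemma IsChild.sz_add {e : ℕ} {X Y : Finset ℕ} (h : IsChild e X Y) : sz Y + e = sz X := by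
  obtain ⟨x, hx, rfl⟩ := h; exact sz_move hx

/-- A position not occupied bounds the number of beads. -/
lemma card_le_of_notMem {X : Finset ℕ} {j : ℕ} (h : j ∉ X) : X.card ≤ j + sz X := by
  rw [← Finset.card_filter_add_card_filter_not (s := X) (fun a => a < j)]
  refine add_le_add (card_filter_lt_le X j) ?_
  calc _ = ∑ x ∈ X.filter (fun a => ¬ a < j), 1 := by simp
    _ ≤ ∑ x ∈ X.filter (fun a => ¬ a < j), gap X x := by
        refine Finset.sum_le_sum fun x hx => ?_
        simp only [Finset.mem_filter, not_lt] at hx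
        have hj : j < x := lt_of_le_of_ne hx.2 (fun e => h (e ▸ hx.1))
        have : (X.filter (fun a => a < x)).card ≤ ((Finset.range x).erase j).card :=
          Finset.card_le_card (by
            intro a; simp only [Finset.mem_filter, Finset.mem_erase, Finset.mem_range]
            rintro ⟨ha, hax⟩; exact ⟨fun e => h (e ▸ ha), hax⟩)
        rw [Finset.card_erase_of_mem (by simpa using hj), Finset.card_range] at this
        unfold gap; omega
    _ ≤ sz X := Finset.sum_le_sum_of_subset (Finset.filter_subset _ _)

lemma range_subset_of_sz {X : Finset ℕ} {j : ℕ} (h : j + sz X ≤ X.card) :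
    Finset.range j ⊆ X := by
  intro i hi
  by_contra hX
  have := card_le_of_notMem hX
  simp at hi; omega

lemma eq_range_of_sz_eq_zero {X : Finset ℕ} (h : sz X = 0) : X = Finset.range X.card :=
  (Finset.eq_of_subset_of_card_le (range_subset_of_sz (by omega)) (by simp)).symm

lemma sz_range (n : ℕ) : sz (Finset.range n) = 0 := by
  have := sum_eq_sz_add (Finset.range n)
  simp at this; omega

lemma lt_of_mem {X : Finset ℕ} {x : ℕ} (h : x ∈ X) : x < sz X + X.card := by
  have h1 : gap X x ≤ sz X := Finset.single_le_sum (f := gap X) (fun _ _ => Nat.zero_le _) h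
  have h2 : (X.filter (fun a => a < x)).card < X.card :=
    Finset.card_lt_card (by
      rw [Finset.filter_ssubset]; exact ⟨x, h, lt_irrefl x⟩)
  unfold gap at h1; omega

lemma sum_partOfBeta (X : Finset ℕ) : (partOfBeta X).sum = sz X := by
  unfold partOfBeta sz gap
  rw [Finset.sum_eq_multiset_sum]
  generalize (Multiset.map _ X.val) = s
  induction s using Multiset.induction_on with
  | empty => simp
  | cons a s ih =>
    rcases Nat.eq_zero_or_pos a with rfl | ha
    · simpa using ih
    · simp [ha, ih]

lemma partOfBeta_pos {X : Finset ℕ} {p : ℕ} (h : p ∈ partOfBeta X) : 0 < p := by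
  unfold partOfBeta at h
  exact (Multiset.mem_filter.1 h).2

lemma partOfBeta_eq_zero_iff {X : Finset ℕ} : partOfBeta X = 0 ↔ sz X = 0 := by
  rw [← sum_partOfBeta]
  constructor
  · intro h; simp [h]
  · intro h
    rw [Multiset.sum_eq_zero_iff] at h
    refine Multiset.eq_zero_of_forall_notMem fun p hp => ?_
    have := partOfBeta_pos hp
    have := h p hp
    omega

lemma gap_move_of_ne {x c : ℕ} {X : Finset ℕ} (h : x ∈ movable 1 X) (hc : c ∈ X) (hcx : c ≠ x) :
    gap (move 1 X x) c = gap X c := by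
  rw [mem_movable] at h
  have hx1 : c ≠ x - 1 := fun e => h.2.2 (e ▸ hc)
  unfold gap move
  congr 1
  rw [Finset.filter_insert, Finset.filter_erase]
  split_ifs with hlt
  · rw [Finset.card_insert_of_notMem (by simp [h.2.2]),
      Finset.card_erase_add_one (by simp only [Finset.mem_filter]; exact ⟨h.1, by omega⟩)]
  · rw [Finset.erase_eq_of_notMem (by simp only [Finset.mem_filter]; omega)]

lemma gap_move_self {x : ℕ} {X : Finset ℕ} (h : x ∈ movable 1 X) :
    gap (move 1 X x) (x - 1) = gap X x - 1 := by
  rw [mem_movable] at h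
  have : (move 1 X x).filter (fun a => a < x - 1) = X.filter (fun a => a < x) := by
    ext a
    simp only [Finset.mem_filter, mem_move]
    constructor
    · rintro ⟨h1 | h1, h2⟩
      · omega
      · exact ⟨h1.2, by omega⟩
    · rintro ⟨h1, h2⟩
      have : a ≠ x - 1 := fun e => h.2.2 (e ▸ h1)
      exact ⟨Or.inr ⟨by omega, h1⟩, by omega⟩
  unfold gap
  rw [this]; omega

lemma gap_pos {x : ℕ} {X : Finset ℕ} (h : x ∈ movable 1 X) : 0 < gap X x := by
  rw [mem_movable] at h
  have : (X.filter (fun a => a < x)).card ≤ ((Finset.range x).erase (x - 1)).card :=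
    Finset.card_le_card (by
      intro a; simp only [Finset.mem_filter, Finset.mem_erase, Finset.mem_range]
      rintro ⟨ha, hax⟩; exact ⟨fun e => h.2.2 (e ▸ ha), hax⟩)
  rw [Finset.card_erase_of_mem (by simp; omega), Finset.card_range] at this
  unfold gap; omega

lemma partOfBeta_move {x : ℕ} {X : Finset ℕ} (h : x ∈ movable 1 X) :
    partOfBeta (move 1 X x) = removeBox (partOfBeta X) (gap X x) := by
  have h' := mem_movable.1 h
  have hX : partOfBeta X = gap X x ::ₘ
      ((X.erase x).val.map (gap X)).filter (fun p => 0 < p) := by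
    conv_lhs => rw [partOfBeta]
    change (X.val.map (gap X)).filter (fun p => 0 < p) = _
    conv_lhs => rw [← Finset.insert_erase h'.1]
    rw [Finset.insert_val_of_notMem (Finset.notMem_erase _ _), Multiset.map_cons,
      Multiset.filter_cons_of_pos _ (by
        rw [Finset.insert_erase h'.1]; exact gap_pos h), Finset.insert_erase h'.1]
  have hY : partOfBeta (move 1 X x) =
      ((gap X x - 1) ::ₘ (X.erase x).val.map (gap X)).filter (fun p => 0 < p) := by
    conv_lhs => rw [partOfBeta]
    change (Multiset.map (gap (move 1 X x)) (move 1 X x).val).filter (fun p => 0 < p) = _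
    conv_lhs => arg 2; arg 2; rw [move]
    rw [Finset.insert_val_of_notMem (by simp [h'.2.2]), Multiset.map_cons, gap_move_self h]
    congr 2
    refine Multiset.map_congr rfl fun c hc => ?_
    have hc : c ∈ X.erase x := hc
    rw [Finset.mem_erase] at hc
    exact gap_move_of_ne h hc.2 hc.1
  rw [hY, hX, removeBox, Multiset.erase_cons_head]
  split_ifs with hp
  · rw [Multiset.filter_cons_of_neg _ (by omega)]
  · rw [Multiset.filter_cons_of_pos _ (by omega)]

lemma gap_mono {X : Finset ℕ} {x y : ℕ} (hxy : x ≤ y) : gap X x ≤ gap X y := by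
  have : (X.filter (fun a => a < y)).card ≤
      ((X.filter (fun a => a < x)) ∪ Finset.Ico x y).card :=
    Finset.card_le_card (by
      intro a; simp only [Finset.mem_filter, Finset.mem_union, Finset.mem_Ico]
      rintro ⟨ha, hay⟩
      rcases lt_or_ge a x with h | h
      · exact Or.inl ⟨ha, h⟩
      · exact Or.inr ⟨h, hay⟩)
  have h2 := Finset.card_union_le (X.filter (fun a => a < x)) (Finset.Ico x y)
  rw [Nat.card_Ico] at h2
  have := card_filter_lt_le X x
  unfold gap; omega

lemma gap_succ_of_notMem {X : Finset ℕ} {x : ℕ} (h : x ∉ X) : gap X (x + 1) = gap X x + 1 := by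
  have : X.filter (fun a => a < x + 1) = X.filter (fun a => a < x) := by
    ext a
    simp only [Finset.mem_filter, and_congr_right_iff]
    intro ha
    have : a ≠ x := fun e => h (e ▸ ha)
    omega
  have hle := card_filter_lt_le X x
  unfold gap
  rw [this]; omega

lemma gap_succ_of_mem {X : Finset ℕ} {x : ℕ} (h : x ∈ X) : gap X (x + 1) = gap X x := by
  have : X.filter (fun a => a < x + 1) = insert x (X.filter (fun a => a < x)) := by
    ext a
    simp only [Finset.mem_filter, Finset.mem_insert]
    constructor
    · rintro ⟨h1, h2⟩
      rcases Nat.lt_succ_iff_lt_or_eq.1 h2 with h3 | h3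
      · exact Or.inr ⟨h1, h3⟩
      · exact Or.inl h3
    · rintro (rfl | ⟨h1, h2⟩)
      · exact ⟨h, by omega⟩
      · exact ⟨h1, by omega⟩
  unfold gap
  rw [this, Finset.card_insert_of_notMem (by simp)]
  omega

lemma gap_injOn (X : Finset ℕ) : Set.InjOn (gap X) (movable 1 X) := by
  have key : ∀ x ∈ movable 1 X, ∀ y ∈ movable 1 X, x < y → gap X x < gap X y := by
    intro x _ y hy hxy
    rw [mem_movable] at hy
    have h1 := gap_succ_of_notMem hy.2.2
    rw [Nat.sub_add_cancel hy.2.1] at h1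
    have := gap_mono (X := X) (Nat.le_sub_one_of_lt hxy)
    omega
  intro x hx y hy h
  rcases lt_trichotomy x y with h1 | h1 | h1
  · exact absurd h (key x hx y hy h1).ne
  · exact h1
  · exact absurd h (key y hy x hx h1).ne'

lemma exists_movable_of_mem {X : Finset ℕ} {p : ℕ} (h : p ∈ partOfBeta X) :
    ∃ x ∈ movable 1 X, gap X x = p := by
  have hp := partOfBeta_pos h
  have hex : ∃ b, b ∈ X ∧ gap X b = p := by
    unfold partOfBeta at h
    obtain ⟨b, hb, hb'⟩ := Multiset.mem_map.1 (Multiset.mem_filter.1 h).1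
    exact ⟨b, hb, hb'⟩
  obtain ⟨hb, hbp⟩ := Nat.find_spec hex
  have hmin := fun m => Nat.find_min hex (m := m)
  generalize Nat.find hex = b at hb hbp hmin
  have hb0 : 1 ≤ b := by
    by_contra hb0
    have : b = 0 := by omega
    subst this
    simp [gap] at hbp; omega
  refine ⟨b, mem_movable.2 ⟨hb, hb0, fun hb1 => hmin (b - 1) (by omega) ⟨hb1, ?_⟩⟩, hbp⟩
  rw [← hbp, ← gap_succ_of_mem hb1, Nat.sub_add_cancel hb0]

lemma gap_mem_partOfBeta {X : Finset ℕ} {x : ℕ} (h : x ∈ movable 1 X) :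
    gap X x ∈ partOfBeta X := by
  unfold partOfBeta
  rw [Multiset.mem_filter]
  exact ⟨Multiset.mem_map.2 ⟨x, (mem_movable.1 h).1, rfl⟩, gap_pos h⟩

/-- The branching rule in terms of bead sets. -/
lemma degSYT_partOfBeta {X : Finset ℕ} (h : sz X ≠ 0) :
    degSYT (partOfBeta X) = ∑ x ∈ movable 1 X, degSYT (partOfBeta (move 1 X x)) := by
  rw [degSYT, dif_neg (by rwa [partOfBeta_eq_zero_iff])]
  rw [Finset.sum_attach _ (fun p => degSYT (removeBox (partOfBeta X) p))]
  symm
  refine Finset.sum_bij (fun x _ => gap X x) ?_ ?_ ?_ ?_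
  · intro x hx
    rw [Finset.mem_filter, Multiset.mem_toFinset]
    exact ⟨gap_mem_partOfBeta hx, gap_pos hx⟩
  · intro x hx y hy h; exact gap_injOn X hx hy h
  · intro p hp
    rw [Finset.mem_filter, Multiset.mem_toFinset] at hp
    obtain ⟨x, hx, hxp⟩ := exists_movable_of_mem hp.1
    exact ⟨x, hx, hxp⟩
  · intro x hx; rw [partOfBeta_move hx]

lemma degSYT_zero : degSYT 0 = 1 := by rw [degSYT]; simp

lemma oddB_of_sz_eq_zero {X : Finset ℕ} (h : sz X = 0) : OddB X := by
  unfold OddB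
  rw [partOfBeta_eq_zero_iff.2 h, degSYT_zero]; exact odd_one

/-- The alternant `∑_σ x^σ` modulo `2`. -/
noncomputable def alternant (M : ℕ) : MvPolynomial (Fin M) (ZMod 2) :=
  ∑ σ : Equiv.Perm (Fin M),
    MvPolynomial.monomial (Finsupp.equivFunOnFinite.symm fun i => (σ i : ℕ)) 1

/-- Symmetric polynomials over `ZMod 2` whose coefficients vanish at exponents with a repetition. -/
def Alternating {M : ℕ} (Q : MvPolynomial (Fin M) (ZMod 2)) : Prop :=
  Q.IsSymmetric ∧ ∀ v : Fin M →₀ ℕ, ¬ Function.Injective v → Q.coeff v = 0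

lemma coeff_alternant {M : ℕ} (v : Fin M →₀ ℕ) :
    (alternant M).coeff v = ∑ σ : Equiv.Perm (Fin M), if (∀ i, (σ i : ℕ) = v i) then 1 else 0 := by
  unfold alternant
  rw [MvPolynomial.coeff_sum]
  refine Finset.sum_congr rfl fun σ _ => ?_
  rw [MvPolynomial.coeff_monomial]
  refine if_congr ?_ rfl rfl
  rw [Finsupp.ext_iff]; rfl

lemma alternating_alternant (M : ℕ) : Alternating (alternant M) := by
  constructor
  · intro e
    unfold alternant
    rw [map_sum]
    refine Fintype.sum_equiv (Equiv.mulRight e⁻¹) _ _ fun σ => ?_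
    rw [MvPolynomial.rename_monomial]
    refine congrArg (fun s => MvPolynomial.monomial s 1) (Finsupp.ext fun i => ?_)
    rw [← Finsupp.equivMapDomain_eq_mapDomain]
    rfl
  · intro v hv
    rw [coeff_alternant]
    refine Finset.sum_eq_zero fun σ _ => if_neg fun h => hv ?_
    intro i j hij
    rw [← h, ← h] at hij
    exact σ.injective (Fin.ext hij)

lemma coeff_psum_mul {M : ℕ} (e : ℕ) (Q : MvPolynomial (Fin M) (ZMod 2)) (v : Fin M →₀ ℕ) :
    (MvPolynomial.psum (Fin M) (ZMod 2) e * Q).coeff v =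
      ∑ i, if e ≤ v i then Q.coeff (v - Finsupp.single i e) else 0 := by
  rw [MvPolynomial.psum, Finset.sum_mul, MvPolynomial.coeff_sum]
  refine Finset.sum_congr rfl fun i _ => ?_
  rw [MvPolynomial.X_pow_eq_monomial, MvPolynomial.coeff_monomial_mul']
  simp [Finsupp.single_le_iff]

lemma sub_single_apply {M : ℕ} (v : Fin M →₀ ℕ) (i j : Fin M) (e : ℕ) :
    (v - Finsupp.single i e) j = if j = i then v i - e else v j := by
  rw [Finsupp.tsub_apply, Finsupp.single_apply]
  by_cases h : i = j
  · subst h; simp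
  · rw [if_neg h, if_neg (Ne.symm h)]; rfl

lemma Alternating.psum_mul {M : ℕ} {Q : MvPolynomial (Fin M) (ZMod 2)} (hQ : Alternating Q)
    (e : ℕ) : Alternating (MvPolynomial.psum (Fin M) (ZMod 2) e * Q) := by
  refine ⟨(MvPolynomial.psum_isSymmetric _ _ e).mul hQ.1, fun v hv => ?_⟩
  rw [Function.not_injective_iff] at hv
  obtain ⟨i, j, hij, hne⟩ := hv
  have heq : Q.coeff (v - Finsupp.single i e) = Q.coeff (v - Finsupp.single j e) := by
    have h := MvPolynomial.coeff_rename_mapDomain (Equiv.swap i j) (Equiv.injective _) Q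
      (v - Finsupp.single i e)
    rw [hQ.1 (Equiv.swap i j)] at h
    rw [← h]
    congr 1
    ext l
    rw [← Finsupp.equivMapDomain_eq_mapDomain, Finsupp.equivMapDomain_apply, Equiv.symm_swap,
      sub_single_apply, sub_single_apply]
    by_cases h1 : l = i
    · subst h1
      rw [Equiv.swap_apply_left, if_neg (Ne.symm hne), if_neg hne, hij]
    · by_cases h2 : l = j
      · subst h2
        rw [Equiv.swap_apply_right, if_pos rfl, if_pos rfl, hij]
      · rw [Equiv.swap_apply_of_ne_of_ne h1 h2, if_neg h1, if_neg h2]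
  rw [coeff_psum_mul, Finset.sum_eq_add i j hne]
  · rw [heq, hij, CharTwo.add_self_eq_zero]
  · rintro l - ⟨hl1, hl2⟩
    split_ifs
    · refine hQ.2 _ fun h => hne (h ?_)
      rw [sub_single_apply, sub_single_apply, if_neg (Ne.symm hl1), if_neg (Ne.symm hl2), hij]
    · rfl
  · simp
  · simp

lemma coeff_psum_mul_eq_sum {M : ℕ} {e n : ℕ} (he : 0 < e) {Q : MvPolynomial (Fin M) (ZMod 2)}
    (hQ : Alternating Q)
    (hd : ∀ w : Fin M →₀ ℕ, Function.Injective w → sz (Finset.univ.image w) = n →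
      Q.coeff w = (degSYT (partOfBeta (Finset.univ.image w)) : ZMod 2))
    (v : Fin M →₀ ℕ) (hv : Function.Injective v) (hn : sz (Finset.univ.image v) = n + e) :
    (MvPolynomial.psum (Fin M) (ZMod 2) e * Q).coeff v =
      ((∑ x ∈ movable e (Finset.univ.image v),
        degSYT (partOfBeta (move e (Finset.univ.image v) x)) : ℕ) : ZMod 2) := by
  rw [coeff_psum_mul, Nat.cast_sum, movable, Finset.sum_filter,
    Finset.sum_image (fun i _ j _ h => hv h)]
  refine Finset.sum_congr rfl fun i _ => ?_
  by_cases h1 : e ≤ v i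
  · by_cases h2 : v i - e ∈ Finset.univ.image v
    · rw [if_pos h1, if_neg (by tauto)]
      obtain ⟨j, -, hj⟩ := Finset.mem_image.1 h2
      have hji : j ≠ i := by rintro rfl; omega
      refine hQ.2 _ fun h => hji (h ?_)
      rw [sub_single_apply, sub_single_apply, if_neg hji, if_pos rfl, hj]
    · rw [if_pos h1, if_pos ⟨h1, h2⟩]
      have him : Finset.univ.image (v - Finsupp.single i e) =
          move e (Finset.univ.image v) (v i) := by
        ext y
        simp only [Finset.mem_image, Finset.mem_univ, true_and, mem_move]
        constructor
        · rintro ⟨j, rfl⟩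
          rw [sub_single_apply]
          split_ifs with hj
          · exact Or.inl rfl
          · exact Or.inr ⟨fun h => hj (hv h), j, rfl⟩
        · rintro (rfl | ⟨h3, j, rfl⟩)
          · exact ⟨i, by rw [sub_single_apply, if_pos rfl]⟩
          · exact ⟨j, by rw [sub_single_apply, if_neg (fun hji => h3 (by rw [hji]))]⟩
      have hmov : v i ∈ movable e (Finset.univ.image v) :=
        mem_movable.2 ⟨Finset.mem_image_of_mem _ (Finset.mem_univ _), h1, h2⟩
      rw [← him]
      refine hd _ ?_ ?_
      · intro j l hjl
        rw [sub_single_apply, sub_single_apply] at hjl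
        split_ifs at hjl with h3 h4 h4
        · rw [h3, h4]
        · exact absurd (hjl ▸ Finset.mem_image_of_mem _ (Finset.mem_univ l)) h2
        · exact absurd (hjl ▸ Finset.mem_image_of_mem _ (Finset.mem_univ j)) h2
        · exact hv hjl
      · have := sz_move hmov
        rw [him]; omega
  · rw [if_neg h1, if_neg (by tauto)]

lemma alternating_psum_pow_mul (M n : ℕ) :
    Alternating (MvPolynomial.psum (Fin M) (ZMod 2) 1 ^ n * alternant M) := by
  induction n with
  | zero => simpa using alternating_alternant M
  | succ n ih => rw [pow_succ', mul_assoc]; exact ih.psum_mul 1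

lemma coeff_psum_pow_mul {M : ℕ} (n : ℕ) (v : Fin M →₀ ℕ) (hv : Function.Injective v)
    (hn : sz (Finset.univ.image v) = n) :
    (MvPolynomial.psum (Fin M) (ZMod 2) 1 ^ n * alternant M).coeff v =
      (degSYT (partOfBeta (Finset.univ.image v)) : ZMod 2) := by
  induction n generalizing v with
  | zero =>
    rw [partOfBeta_eq_zero_iff.2 hn, degSYT_zero, pow_zero, one_mul, coeff_alternant]
    have hr := eq_range_of_sz_eq_zero hn
    rw [Finset.card_image_of_injective _ hv, Finset.card_univ, Fintype.card_fin] at hr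
    have hlt : ∀ i, v i < M := fun i => by
      rw [← Finset.mem_range, ← hr]; exact Finset.mem_image_of_mem _ (Finset.mem_univ _)
    have hinj : Function.Injective (fun i => (⟨v i, hlt i⟩ : Fin M)) := fun i j h => by
      simpa [Fin.ext_iff, hv.eq_iff] using h
    rw [Finset.sum_eq_single (Equiv.ofBijective _ (Finite.injective_iff_bijective.1 hinj))]
    · simp
    · intro σ _ hσ
      refine if_neg fun h => hσ ?_
      ext i
      simp [h]
    · simp
  | succ n ih =>
    rw [pow_succ', mul_assoc,
      coeff_psum_mul_eq_sum one_pos (alternating_psum_pow_mul M n) ih v hv hn,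
      ← degSYT_partOfBeta (by omega)]

/-- Modulo `2`, the degree is the sum of the degrees after removing a hook of length `2 ^ k`. -/
lemma degSYT_cast_eq_sum_hooks {X : Finset ℕ} {k : ℕ} (h : 2 ^ k ≤ sz X) :
    (degSYT (partOfBeta X) : ZMod 2) =
      ((∑ x ∈ movable (2 ^ k) X, degSYT (partOfBeta (move (2 ^ k) X x)) : ℕ) : ZMod 2) := by
  obtain ⟨n, hn⟩ := Nat.exists_eq_add_of_le' h
  let v : Fin X.card →₀ ℕ := Finsupp.equivFunOnFinite.symm (X.orderEmbOfFin rfl)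
  have hv : Function.Injective v := (X.orderEmbOfFin rfl).injective
  have hX : Finset.univ.image v = X := by
    apply Finset.coe_injective
    rw [Finset.coe_image, Finset.coe_univ, Set.image_univ]
    exact Finset.range_orderEmbOfFin X rfl
  have h1 := coeff_psum_pow_mul (n + 2 ^ k) v hv (by rw [hX, hn])
  have h2 := coeff_psum_mul_eq_sum (e := 2 ^ k) (by positivity)
    (alternating_psum_pow_mul X.card n) (coeff_psum_pow_mul n) v hv (by rw [hX, hn])
  rw [hX] at h1 h2
  rw [← h1, ← h2, pow_add, mul_comm (_ ^ n), mul_assoc]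
  congr 2
  rw [MvPolynomial.psum, sum_pow_char_pow, MvPolynomial.psum]
  simp

lemma odd_card_oddB_hooks {X : Finset ℕ} {k : ℕ} (h : 2 ^ k ≤ sz X) :
    OddB X ↔ Odd ((movable (2 ^ k) X).filter (fun x => OddB (move (2 ^ k) X x))).card := by
  unfold OddB
  rw [← ZMod.natCast_eq_one_iff_odd, degSYT_cast_eq_sum_hooks h, ZMod.natCast_eq_one_iff_odd,
    Finset.odd_sum_iff_odd_card_odd]
  congr!

lemma le_sz_of_mem_movable {e x : ℕ} {X : Finset ℕ} (h : x ∈ movable e X) : e ≤ sz X := by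
  have := sz_move h; omega

lemma movable_unique {e x y : ℕ} {X : Finset ℕ} (hX : sz X < 2 * e) (hx : x ∈ movable e X)
    (hy : y ∈ movable e X) : x = y := by
  by_contra hxy
  have h1 := sz_move hx
  have h2 : y ∈ movable e (move e X x) := by
    rw [mem_movable] at hx hy ⊢
    simp only [mem_move]
    refine ⟨Or.inr ⟨Ne.symm hxy, hy.1⟩, hy.2.1, ?_⟩
    rintro (h | h)
    · omega
    · exact hy.2.2 h.2
  have := le_sz_of_mem_movable h2
  omega

lemma sub_mem_of_sz_lt {e x : ℕ} {X : Finset ℕ} (hX : sz X < e) (hx : x ∈ X) (hex : e ≤ x) :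
    x - e ∈ X := by
  by_contra h
  have := le_sz_of_mem_movable (mem_movable.2 ⟨hx, hex, h⟩)
  omega

lemma OddB.exists_child {X : Finset ℕ} {k : ℕ} (hX : OddB X) (h : 2 ^ k ≤ sz X) :
    ∃ x ∈ movable (2 ^ k) X, OddB (move (2 ^ k) X x) := by
  have := ((odd_card_oddB_hooks h).1 hX).pos
  obtain ⟨x, hx⟩ := Finset.card_pos.1 this
  rw [Finset.mem_filter] at hx
  exact ⟨x, hx⟩

/-- A partition of `n`, with `2 ^ t ≤ n < 2 ^ (t + 1)`, is odd if and only if it has an odd child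
by removal of a `2 ^ t`-hook. -/
lemma oddB_iff_exists_child {X : Finset ℕ} {t : ℕ} (h : 2 ^ t ≤ sz X) (h' : sz X < 2 * 2 ^ t) :
    OddB X ↔ ∃ Y, IsChild (2 ^ t) X Y ∧ OddB Y := by
  constructor
  · intro hX
    obtain ⟨x, hx, hx'⟩ := hX.exists_child h
    exact ⟨_, ⟨x, hx, rfl⟩, hx'⟩
  · rintro ⟨_, ⟨x, hx, rfl⟩, hY⟩
    rw [odd_card_oddB_hooks h]
    have : (movable (2 ^ t) X).filter (fun x => OddB (move (2 ^ t) X x)) = {x} := by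
      ext z
      rw [Finset.mem_filter, Finset.mem_singleton]
      constructor
      · rintro ⟨hz, -⟩; exact movable_unique h' hz hx
      · rintro rfl; exact ⟨hx, hY⟩
    rw [this]; simp

lemma exists_common_descendant {e g x y y' : ℕ} {X : Finset ℕ} (hg : 0 < g) (hge : g < e)
    (hn : sz X < 2 * e) (hx : x ∈ movable g X) (hy : y ∈ movable e X)
    (hy' : y' ∈ movable e (move g X x)) :
    ∃ u ∈ movable g (move e X y), move g (move e X y) u = move e (move g X x) y' ∧
      (u = x ∨ (x = y ∧ u = y - e) ∨ (u = x + e ∧ u = y + g)) := by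
  have hZ : sz (move e (move g X x) y') < e := by
    have := sz_move hx
    have := sz_move hy'
    omega
  have hsub : ∀ w ∈ move e (move g X x) y', e ≤ w → w - e ∈ move e (move g X x) y' :=
    fun w hw => sub_mem_of_sz_lt hZ hw
  have huniq : ∀ w ∈ movable e X, w = y := fun w hw => movable_unique hn hw hy
  simp only [mem_movable, mem_move] at hx hy hy' hsub huniq ⊢
  obtain ⟨hx1, hx2, hx3⟩ := hx
  obtain ⟨hy1, hy2, hy3⟩ := hy
  obtain ⟨h1, h2, h3⟩ := hy'
  have hsuby := hsub y
  have huy := huniq y'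
  have hux := huniq x
  clear hsub huniq
  by_cases hc : y' = x - g
  · have hxe : x - e ∉ X := by
      intro hxe
      have hyx : y ≠ x := by rintro rfl; exact hy3 hxe
      have hyg : y ≠ x - g := by rintro rfl; exact hx3 hy1
      rcases hsuby (Or.inr ⟨by omega, Or.inr ⟨hyx, hy1⟩⟩) hy2 with h | ⟨hne, h | h⟩
      · omega
      · omega
      · exact hy3 h.2
    have hxy : x = y := hux ⟨hx1, by omega, hxe⟩
    subst hxy
    refine ⟨x - e, ⟨Or.inl rfl, by omega, ?_⟩, ?_, Or.inr (Or.inl ⟨rfl, rfl⟩)⟩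
    · rintro (h | h)
      · omega
      · exact h3 (Or.inr ⟨by omega, by rw [hc, Nat.sub_right_comm]; exact h.2⟩)
    · ext w
      simp only [mem_move]
      have : x - g - e = x - e - g := Nat.sub_right_comm ..
      rw [hc, this]
      constructor
      · rintro (h | ⟨h, h' | h'⟩)
        · exact Or.inl h
        · exact absurd h' h
        · exact Or.inr ⟨by rintro rfl; exact hx3 h'.2, Or.inr h'⟩
      · rintro (h | ⟨h, h' | h'⟩)
        · exact Or.inl h
        · exact absurd h' h
        · exact Or.inr ⟨by rintro rfl; exact hy3 h'.2, Or.inr h'⟩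
  · have h1 : y' ≠ x ∧ y' ∈ X := by tauto
    by_cases hc2 : y' - e = x
    · have hyx : y ≠ x := by
        rintro rfl
        rcases hsuby (Or.inl hc2.symm) hy2 with h | ⟨-, h | h⟩
        · omega
        · omega
        · exact hy3 h.2
      have hyy : y ≠ y' := by rintro rfl; exact hy3 (hc2 ▸ hx1)
      have hyg : y - e = x - g := by
        rcases hsuby (Or.inr ⟨hyy, Or.inr ⟨hyx, hy1⟩⟩) hy2 with h | ⟨-, h | h⟩
        · omega
        · exact h
        · exact absurd h.2 hy3
      have hye : y' = x + e := by omega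
      subst hye
      refine ⟨x + e, ⟨Or.inr ⟨by omega, h1.2⟩, by omega, ?_⟩, ?_, by omega⟩
      · rintro (h | h)
        · omega
        · exact h.1 (by omega)
      · ext w
        simp only [mem_move]
        have h7 : x + e - g = y := by omega
        have h8 : x + e - e = x := by omega
        rw [h7, h8, hyg]
        by_cases hw1 : w = y
        · subst hw1; simp [hyy, hyx, hy1]
        by_cases hw2 : w = x
        · subst hw2; simp [hx1, Ne.symm hyx]; omega
        by_cases hw3 : w = x - g
        · subst hw3; simp; omega
        simp [hw1, hw2, hw3]
    · have hyy : y' = y := huy ⟨h1.2, h2, by tauto⟩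
      subst hyy
      have hxe : x ≠ y' - e := fun h => hc2 h.symm
      have hxg : y' - e ≠ x - g := by tauto
      refine ⟨x, ⟨Or.inr ⟨Ne.symm h1.1, hx1⟩, hx2, ?_⟩, ?_, Or.inl rfl⟩
      · rintro (h | h)
        · exact hxg h.symm
        · exact hx3 h.2
      · ext w
        simp only [mem_move]
        by_cases hw1 : w = y'
        · subst hw1; simp [h1.1, hc]
        by_cases hw2 : w = x
        · subst hw2; simp [hxe]; omega
        simp only [hw1, hw2, ne_eq, not_false_eq_true, true_and]
        exact or_left_comm

/-- An odd partition has at most one odd child by removal of a `2 ^ k`-hook. -/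
lemma OddB.movable_unique {X : Finset ℕ} {k : ℕ} (hX : OddB X) {x₁ x₂ : ℕ}
    (h₁ : x₁ ∈ movable (2 ^ k) X) (h₂ : x₂ ∈ movable (2 ^ k) X)
    (ho₁ : OddB (move (2 ^ k) X x₁)) (ho₂ : OddB (move (2 ^ k) X x₂)) : x₁ = x₂ := by
  induction hn : sz X using Nat.strong_induction_on generalizing X x₁ x₂ with
  | _ n ih =>
  subst hn
  have hk := le_sz_of_mem_movable h₁
  have hpos : 0 < 2 ^ k := by positivity
  have ht1 : 2 ^ Nat.log 2 (sz X) ≤ sz X := Nat.pow_log_le_self 2 (by omega)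
  have ht2 : sz X < 2 * 2 ^ Nat.log 2 (sz X) := by
    rw [← pow_succ']; exact Nat.lt_pow_succ_log_self one_lt_two _
  generalize Nat.log 2 (sz X) = t at ht1 ht2
  have hkt : k ≤ t := by
    by_contra hkt
    have : 2 ^ (t + 1) ≤ 2 ^ k := Nat.pow_le_pow_right two_pos (by omega)
    rw [pow_succ'] at this; omega
  rcases hkt.eq_or_lt with rfl | hkt
  · exact OddSym.movable_unique ht2 h₁ h₂
  have hge : 2 ^ k < 2 ^ t := Nat.pow_lt_pow_right one_lt_two hkt
  obtain ⟨y, hy, hyo⟩ := hX.exists_child ht1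
  have hszy := sz_move hy
  by_cases hcase : sz X < 2 ^ t + 2 ^ k
  · have hsub : movable (2 ^ k) X ⊆ {y, y - 2 ^ t + 2 ^ k} := by
      intro z hz
      have hcl := sub_mem_of_sz_lt (e := 2 ^ k) (x := z) (X := move (2 ^ t) X y) (by omega)
      rw [mem_movable] at hz hy
      simp only [mem_move] at hcl
      simp only [Finset.mem_insert, Finset.mem_singleton]
      by_contra hcon
      rw [not_or] at hcon
      rcases hcl (Or.inr ⟨hcon.1, hz.1⟩) hz.2.1 with h | h
      · omega
      · exact hz.2.2 h.2
    by_contra hne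
    have hodd := (odd_card_oddB_hooks hk).1 hX
    have hle : ((movable (2 ^ k) X).filter (fun x => OddB (move (2 ^ k) X x))).card ≤ 2 :=
      (Finset.card_le_card ((Finset.filter_subset _ _).trans hsub)).trans Finset.card_le_two
    have hge : 2 ≤ ((movable (2 ^ k) X).filter (fun x => OddB (move (2 ^ k) X x))).card := by
      refine (Finset.card_pair hne).symm.le.trans (Finset.card_le_card fun z hz => ?_)
      simp only [Finset.mem_insert, Finset.mem_singleton] at hz
      rw [Finset.mem_filter]
      rcases hz with rfl | rfl
      · exact ⟨h₁, ho₁⟩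
      · exact ⟨h₂, ho₂⟩
    rw [le_antisymm hle hge] at hodd
    exact absurd hodd (by decide)
  · have key : ∀ x ∈ movable (2 ^ k) X, OddB (move (2 ^ k) X x) →
        ∃ u ∈ movable (2 ^ k) (move (2 ^ t) X y), OddB (move (2 ^ k) (move (2 ^ t) X y) u) ∧
        (u = x ∨ (x = y ∧ u = y - 2 ^ t) ∨ (u = x + 2 ^ t ∧ u = y + 2 ^ k)) := by
      intro x hx hxo
      have := sz_move hx
      obtain ⟨y', hy', hyo'⟩ := hxo.exists_child (k := t) (by omega)
      obtain ⟨u, hu, he, h⟩ := exists_common_descendant hpos hge ht2 hx hy hy'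
      exact ⟨u, hu, he ▸ hyo', h⟩
    obtain ⟨u₁, hu₁, huo₁, hc₁⟩ := key x₁ h₁ ho₁
    obtain ⟨u₂, hu₂, huo₂, hc₂⟩ := key x₂ h₂ ho₂
    have huu : u₁ = u₂ := ih _ (by omega) hyo hu₁ hu₂ huo₁ huo₂ rfl
    subst huu
    rw [mem_movable] at hy h₁ h₂
    obtain ⟨hy1, hy2, hy3⟩ := hy
    rcases hc₁ with h | h | h <;> rcases hc₂ with h' | h' | h' <;> try omega
    · exact absurd (by rw [← h'.2, h]; exact h₁.1) hy3
    · exact absurd (by rw [← h, h'.2, Nat.add_sub_cancel]; exact hy1) h₁.2.2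
    · exact absurd (by rw [← h.2, h']; exact h₂.1) hy3
    · exact absurd (by rw [← h', h.2, Nat.add_sub_cancel]; exact hy1) h₂.2.2

/-- The odd child of `X` by removal of a `2 ^ k`-hook. -/
noncomputable def op (k : ℕ) (X : Finset ℕ) : Finset ℕ :=
  if h : ∃ Y, IsChild (2 ^ k) X Y ∧ OddB Y then h.choose else ∅

lemma OddB.op_spec {X : Finset ℕ} {k : ℕ} (hX : OddB X) (h : 2 ^ k ≤ sz X) :
    IsChild (2 ^ k) X (op k X) ∧ OddB (op k X) := by
  obtain ⟨x, hx, hxo⟩ := hX.exists_child h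
  have hex : ∃ Y, IsChild (2 ^ k) X Y ∧ OddB Y := ⟨_, ⟨x, hx, rfl⟩, hxo⟩
  rw [op, dif_pos hex]
  exact hex.choose_spec

lemma OddB.eq_op {X Y : Finset ℕ} {k : ℕ} (hX : OddB X) (hY : IsChild (2 ^ k) X Y)
    (hYo : OddB Y) : Y = op k X := by
  obtain ⟨x, hx, rfl⟩ := hY
  obtain ⟨⟨z, hz, hz'⟩, hzo⟩ := hX.op_spec (le_sz_of_mem_movable hx)
  rw [hz'] at hzo ⊢
  rw [hX.movable_unique hx hz hYo hzo]

lemma descList_coe (lam : Multiset ℕ) : (descList lam : Multiset ℕ) = lam := by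
  rw [descList, Multiset.coe_reverse, Multiset.sort_eq]

lemma length_descList (lam : Multiset ℕ) : (descList lam).length = Multiset.card lam := by
  rw [← Multiset.coe_card, descList_coe]

lemma descList_getD_antitone (lam : Multiset ℕ) : Antitone (fun i => (descList lam).getD i 0) := by
  intro i j hij
  have hs : (descList lam).Pairwise (· ≥ ·) := by
    rw [descList, List.pairwise_reverse]
    exact Multiset.pairwise_sort lam (· ≤ ·)
  by_cases hj : j < (descList lam).length
  · have hi : i < (descList lam).length := by omega
    simp only [List.getD_eq_getElem _ _ hj, List.getD_eq_getElem _ _ hi]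
    rcases hij.eq_or_lt with rfl | h
    · exact le_rfl
    · exact List.pairwise_iff_getElem.1 hs i j hi hj h
  · simp only [List.getD_eq_default _ _ (not_lt.1 hj), zero_le]

lemma card_betaSet (lam : Multiset ℕ) (m : ℕ) : (betaSet lam m).card = m := by
  rw [betaSet, Finset.card_image_of_injOn, Finset.card_range]
  intro i hi j hj h
  simp only [Finset.coe_range, Set.mem_Iio] at hi hj h
  rcases lt_trichotomy i j with hij | hij | hij
  · have := descList_getD_antitone lam hij.le; simp only at this; omega
  · exact hij
  · have := descList_getD_antitone lam hij.le; simp only at this; omega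

lemma gap_betaSet {lam : Multiset ℕ} {m i : ℕ} (hi : i < m) :
    gap (betaSet lam m) ((descList lam).getD i 0 + (m - 1 - i)) = (descList lam).getD i 0 := by
  have : ((betaSet lam m).filter
      (fun a => a < (descList lam).getD i 0 + (m - 1 - i))).card = m - 1 - i := by
    have he : (betaSet lam m).filter (fun a => a < (descList lam).getD i 0 + (m - 1 - i)) =
        (Finset.Ioo i m).image (fun i => (descList lam).getD i 0 + (m - 1 - i)) := by
      ext y
      simp only [betaSet, Finset.mem_filter, Finset.mem_image, Finset.mem_range, Finset.mem_Ioo]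
      constructor
      · rintro ⟨⟨j, hj, rfl⟩, h⟩
        refine ⟨j, ⟨?_, hj⟩, rfl⟩
        by_contra hij
        have := descList_getD_antitone lam (not_lt.1 hij); simp only at this; omega
      · rintro ⟨j, ⟨hij, hj⟩, rfl⟩
        have := descList_getD_antitone lam hij.le; simp only at this
        exact ⟨⟨j, hj, rfl⟩, by omega⟩
    rw [he, Finset.card_image_of_injOn, Nat.card_Ioo]
    · omega
    intro a ha b hb h
    simp only [Finset.coe_Ioo, Set.mem_Ioo] at ha hb h
    rcases lt_trichotomy a b with hij | hij | hij
    · have := descList_getD_antitone lam hij.le; simp only at this; omega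
    · exact hij
    · have := descList_getD_antitone lam hij.le; simp only at this; omega
  rw [gap, this]; omega

lemma partOfBeta_betaSet {lam : Multiset ℕ} {m : ℕ} (hpos : ∀ x ∈ lam, 0 < x)
    (hm : Multiset.card lam ≤ m) : partOfBeta (betaSet lam m) = lam := by
  have hinj : Set.InjOn (fun i => (descList lam).getD i 0 + (m - 1 - i)) (Finset.range m) := by
    rw [← Finset.card_image_iff]
    exact (card_betaSet lam m).trans (Finset.card_range m).symm
  have h1 : (betaSet lam m).val.map (gap (betaSet lam m)) =
      (Finset.range m).val.map (fun i => (descList lam).getD i 0) := by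
    conv_lhs => rw [betaSet, Finset.image_val_of_injOn hinj, Multiset.map_map]
    refine Multiset.map_congr rfl fun i hi => ?_
    exact gap_betaSet (by simpa using hi)
  have h2 : (Finset.range m).val.map (fun i => (descList lam).getD i 0) =
      lam + Multiset.replicate (m - Multiset.card lam) 0 := by
    conv_rhs => rw [← descList_coe lam]
    rw [Finset.range_val, ← Multiset.coe_range, Multiset.map_coe, ← Multiset.coe_replicate,
      Multiset.coe_add]
    congr 1
    refine List.ext_getElem ?_ fun i h1 h2 => ?_
    · simp [length_descList, hm]
    · simp only [List.getElem_map, List.getElem_range]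
      by_cases hi : i < (descList lam).length
      · rw [List.getElem_append_left hi, List.getD_eq_getElem _ _ hi]
      · rw [List.getElem_append_right (not_lt.1 hi), List.getElem_replicate,
          List.getD_eq_default _ _ (not_lt.1 hi)]
  change Multiset.filter _ ((betaSet lam m).val.map (gap (betaSet lam m))) = _
  rw [h1, h2, Multiset.filter_add, Multiset.filter_eq_self.2 hpos, Multiset.filter_eq_nil.2,
    add_zero]
  intro a ha
  rw [Multiset.eq_of_mem_replicate ha]; simp

lemma card_partOfBeta_le (X : Finset ℕ) : Multiset.card (partOfBeta X) ≤ X.card := by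
  unfold partOfBeta
  refine (Multiset.card_le_card (Multiset.filter_le _ _)).trans ?_
  simp

lemma gap_insert_max {s : Finset ℕ} {m : ℕ} (hm : ∀ x ∈ s, x < m) :
    (insert m s).val.map (gap (insert m s)) = (m - s.card) ::ₘ s.val.map (gap s) := by
  have hms : m ∉ s := fun h => lt_irrefl _ (hm m h)
  rw [Finset.insert_val_of_notMem hms, Multiset.map_cons]
  congr 1
  · unfold gap
    congr 2
    ext a
    simp only [Finset.mem_filter, Finset.mem_insert]
    constructor
    · rintro ⟨rfl | h, h'⟩
      · omega
      · exact h
    · exact fun h => ⟨Or.inr h, hm a h⟩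
  · refine Multiset.map_congr rfl fun x hx => ?_
    unfold gap
    congr 2
    ext a
    simp only [Finset.mem_filter, Finset.mem_insert]
    have := hm x hx
    constructor
    · rintro ⟨rfl | h, h'⟩
      · omega
      · exact ⟨h, h'⟩
    · exact fun h => ⟨Or.inr h.1, h.2⟩

lemma card_le_of_forall_lt {s : Finset ℕ} {m : ℕ} (hm : ∀ x ∈ s, x < m) : s.card ≤ m := by
  simpa using Finset.card_le_card (fun x hx => Finset.mem_range.2 (hm x hx) : s ⊆ Finset.range m)

lemma gap_le_of_forall_lt {s : Finset ℕ} {m g : ℕ} (hm : ∀ x ∈ s, x < m)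
    (hg : g ∈ s.val.map (gap s)) : g ≤ m - s.card := by
  obtain ⟨x, hx, rfl⟩ := Multiset.mem_map.1 hg
  have h1 := gap_mono (X := s) (hm x hx).le
  refine h1.trans ?_
  unfold gap
  rw [Finset.filter_true_of_mem hm]

lemma eq_of_map_gap_eq {X Y : Finset ℕ} (h : X.val.map (gap X) = Y.val.map (gap Y)) : X = Y := by
  induction X using Finset.induction_on_max generalizing Y with
  | empty =>
    have : Y.val.map (gap Y) = 0 := by rw [← h]; simp
    simpa [eq_comm] using this
  | insert m s hm ih =>
    induction Y using Finset.induction_on_max with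
    | empty =>
      rw [gap_insert_max hm] at h
      simp at h
    | insert m' s' hm' _ =>
      have hc : s.card = s'.card := by
        have h0 := congrArg Multiset.card h
        rw [gap_insert_max hm, gap_insert_max hm'] at h0
        simpa using h0
      rw [gap_insert_max hm, gap_insert_max hm'] at h
      have h1 : m - s.card ≤ m' - s'.card := by
        have : m - s.card ∈ (m' - s'.card) ::ₘ s'.val.map (gap s') := by
          rw [← h]; exact Multiset.mem_cons_self _ _
        rcases Multiset.mem_cons.1 this with h | h
        · exact h.le
        · exact gap_le_of_forall_lt hm' h
      have h2 : m' - s'.card ≤ m - s.card := by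
        have : m' - s'.card ∈ (m - s.card) ::ₘ s.val.map (gap s) := by
          rw [h]; exact Multiset.mem_cons_self _ _
        rcases Multiset.mem_cons.1 this with h | h
        · exact h.le
        · exact gap_le_of_forall_lt hm h
      have h3 := card_le_of_forall_lt hm
      have h4 := card_le_of_forall_lt hm'
      rw [le_antisymm h1 h2, Multiset.cons_inj_right] at h
      rw [ih h, show m = m' by omega]

/-- The bead set is determined by the partition and the number of beads. -/
lemma eq_of_partOfBeta_eq {X Y : Finset ℕ} (hc : X.card = Y.card)
    (h : partOfBeta X = partOfBeta Y) : X = Y := by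
  refine eq_of_map_gap_eq ?_
  have key : ∀ Z : Finset ℕ, Z.val.map (gap Z) =
      partOfBeta Z + Multiset.replicate (Z.card - Multiset.card (partOfBeta Z)) 0 := by
    intro Z
    have h1 := Multiset.filter_add_not (fun p => 0 < p) (Z.val.map (gap Z))
    have h2 : (Z.val.map (gap Z)).filter (fun p => ¬ 0 < p) =
        Multiset.replicate (Multiset.card ((Z.val.map (gap Z)).filter (fun p => ¬ 0 < p))) 0 :=
      Multiset.eq_replicate_card.2 fun b hb => by
        have := (Multiset.mem_filter.1 hb).2; omega
    have h3 := congrArg Multiset.card h1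
    rw [Multiset.card_add, Multiset.card_map] at h3
    change Multiset.card (partOfBeta Z) + _ = Z.card at h3
    rw [h2] at h1
    rw [← h3, Nat.add_sub_cancel_left]
    exact h1.symm
  rw [key X, key Y, h, hc]

lemma betaSet_partOfBeta {X : Finset ℕ} {m : ℕ} (hm : X.card = m) :
    betaSet (partOfBeta X) m = X :=
  eq_of_partOfBeta_eq ((card_betaSet _ _).trans hm.symm)
    (partOfBeta_betaSet (fun _ => partOfBeta_pos) ((card_partOfBeta_le X).trans hm.le))

/-- Add a bead at the bottom, shifting all other beads up. -/
def shift (X : Finset ℕ) : Finset ℕ := insert 0 (X.image Nat.succ)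

lemma zero_mem_shift (X : Finset ℕ) : 0 ∈ shift X := by simp [shift]

lemma succ_mem_shift {X : Finset ℕ} {x : ℕ} : x + 1 ∈ shift X ↔ x ∈ X := by
  simp [shift]

lemma shift_injective : Function.Injective shift := by
  intro X Y h
  ext x
  rw [← succ_mem_shift, h, succ_mem_shift]

lemma betaSet_succ {lam : Multiset ℕ} {m : ℕ} (hm : Multiset.card lam ≤ m) :
    betaSet lam (m + 1) = shift (betaSet lam m) := by
  ext y
  rcases y with _ | y
  · simp only [zero_mem_shift, iff_true]
    rw [betaSet, Finset.mem_image]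
    refine ⟨m, by simp, ?_⟩
    rw [List.getD_eq_default _ _ (by rwa [length_descList])]
    omega
  · rw [succ_mem_shift]
    simp only [betaSet, Finset.mem_image, Finset.mem_range]
    constructor
    · rintro ⟨i, hi, h⟩
      rcases Nat.lt_succ_iff_lt_or_eq.1 hi with hi | rfl
      · exact ⟨i, hi, by omega⟩
      · rw [List.getD_eq_default _ _ (by rwa [length_descList])] at h
        omega
    · rintro ⟨i, hi, h⟩
      exact ⟨i, by omega, by omega⟩

lemma isChild_shift {e : ℕ} (he : 0 < e) {X Y : Finset ℕ} :
    IsChild e (shift X) (shift Y) ↔ IsChild e X Y := by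
  have key : ∀ x ∈ movable e X, x + 1 ∈ movable e (shift X) ∧
      move e (shift X) (x + 1) = shift (move e X x) := by
    intro x hx
    rw [mem_movable] at hx ⊢
    have hs : x + 1 - e = x - e + 1 := by omega
    refine ⟨⟨succ_mem_shift.2 hx.1, by omega, by rw [hs, succ_mem_shift]; exact hx.2.2⟩, ?_⟩
    ext y
    rcases y with _ | y
    · simp [mem_move, zero_mem_shift]
    · rw [mem_move, succ_mem_shift, succ_mem_shift, mem_move, hs]
      simp
  constructor
  · rintro ⟨z, hz, h⟩
    have hz' := mem_movable.1 hz
    obtain ⟨x, rfl⟩ : ∃ x, z = x + 1 := ⟨z - 1, by omega⟩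
    have hne : x + 1 - e ≠ 0 := fun h0 => hz'.2.2 (h0 ▸ zero_mem_shift X)
    have hs : x + 1 - e = x - e + 1 := by omega
    have hx : x ∈ movable e X := by
      rw [mem_movable]
      refine ⟨succ_mem_shift.1 hz'.1, by omega, ?_⟩
      rw [← succ_mem_shift, ← hs]; exact hz'.2.2
    rw [(key x hx).2] at h
    exact ⟨x, hx, shift_injective h⟩
  · rintro ⟨x, hx, rfl⟩
    exact ⟨x + 1, (key x hx).1, (key x hx).2.symm⟩

lemma isChild_betaSet_iff {e m M : ℕ} (he : 0 < e) {lam mu : Multiset ℕ}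
    (h1 : Multiset.card lam ≤ m) (h2 : Multiset.card mu ≤ m) (hM : m ≤ M) :
    IsChild e (betaSet lam M) (betaSet mu M) ↔ IsChild e (betaSet lam m) (betaSet mu m) := by
  induction M, hM using Nat.le_induction with
  | base => rfl
  | succ M hM ih =>
    rw [betaSet_succ (h1.trans hM), betaSet_succ (h2.trans hM), isChild_shift he, ih]

lemma isHookRemoval_iff {e M : ℕ} (he : 0 < e) {lam mu : Multiset ℕ}
    (h1 : Multiset.card lam ≤ M) (h2 : Multiset.card mu ≤ M) (hl : ∀ x ∈ lam, 0 < x)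
    (hmu : ∀ x ∈ mu, 0 < x) :
    IsHookRemoval e lam mu ↔ IsChild e (betaSet lam M) (betaSet mu M) := by
  constructor
  · rintro ⟨-, -, -, m, x, hm1, hm2, hx1, hx2, hx3, h⟩
    rw [← isChild_betaSet_iff he h1 h2 (le_max_left M m),
      isChild_betaSet_iff he hm1 hm2 (le_max_right M m)]
    exact ⟨x, mem_movable.2 ⟨hx1, hx2, hx3⟩, by rw [h, move]⟩
  · rintro ⟨x, hx, h⟩
    rw [mem_movable] at hx
    exact ⟨hl, hmu, he, M, x, h1, h2, hx.1, hx.2.1, hx.2.2, by rw [h, move]⟩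

lemma card_le_sum_of_pos {s : Multiset ℕ} (h : ∀ x ∈ s, 0 < x) : Multiset.card s ≤ s.sum := by
  have := Multiset.card_nsmul_le_sum (s := s) (a := 1) h
  simpa using this

lemma IsHookRemoval.sum_add {e : ℕ} {lam mu : Multiset ℕ} (h : IsHookRemoval e lam mu) :
    mu.sum + e = lam.sum := by
  obtain ⟨hl, hmu, he, m, x, hm1, hm2, hx1, hx2, hx3, h⟩ := h
  have hc : IsChild e (betaSet lam m) (betaSet mu m) :=
    ⟨x, mem_movable.2 ⟨hx1, hx2, hx3⟩, by rw [h, move]⟩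
  have := hc.sz_add
  rwa [← sum_partOfBeta, ← sum_partOfBeta, partOfBeta_betaSet hl hm1,
    partOfBeta_betaSet hmu hm2] at this

lemma oddP_partOfBeta {X : Finset ℕ} : OddP (partOfBeta X) ↔ OddB X :=
  ⟨fun h => h.2, fun h => ⟨fun _ => partOfBeta_pos, h⟩⟩

lemma fkOp_partOfBeta {X : Finset ℕ} {k : ℕ} (hX : OddB X) (hk : 2 ^ k ≤ sz X)
    (hc : sz X ≤ X.card) : fkOp k (partOfBeta X) = partOfBeta (op k X) := by
  obtain ⟨h1, h2⟩ := hX.op_spec hk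
  have hpos : 0 < 2 ^ k := by positivity
  have hex : ∃ mu, IsHookRemoval (2 ^ k) (partOfBeta X) mu ∧ OddP mu := by
    refine ⟨partOfBeta (op k X), ?_, oddP_partOfBeta.2 h2⟩
    rw [isHookRemoval_iff hpos (card_partOfBeta_le X)
      ((card_partOfBeta_le _).trans h1.card_eq.le) (fun _ => partOfBeta_pos)
      (fun _ => partOfBeta_pos), betaSet_partOfBeta rfl, betaSet_partOfBeta h1.card_eq]
    exact h1
  rw [fkOp, dif_pos hex]
  obtain ⟨h3, h4⟩ := hex.choose_spec
  generalize hex.choose = mu at h3 h4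
  have hsum := h3.sum_add
  have hcard := card_le_sum_of_pos h4.1
  rw [sum_partOfBeta] at hsum
  have hmc : Multiset.card mu ≤ X.card := by omega
  rw [isHookRemoval_iff hpos (card_partOfBeta_le X) hmc (fun _ => partOfBeta_pos) h4.1,
    betaSet_partOfBeta rfl] at h3
  have hodd : OddB (betaSet mu X.card) := by
    rw [← oddP_partOfBeta, partOfBeta_betaSet h4.1 hmc]; exact h4
  rw [← hX.eq_op h3 hodd, partOfBeta_betaSet h4.1 hmc]

/-- The odd bead sets with `M` beads encoding a partition of `n`. -/
noncomputable def oddSets (M n : ℕ) : Finset (Finset ℕ) :=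
  ((Finset.range (n + M)).powersetCard M).filter (fun X => OddB X ∧ sz X = n)

lemma mem_oddSets {M n : ℕ} {X : Finset ℕ} :
    X ∈ oddSets M n ↔ X.card = M ∧ sz X = n ∧ OddB X := by
  simp only [oddSets, Finset.mem_filter, Finset.mem_powersetCard]
  constructor
  · rintro ⟨⟨h1, h2⟩, h3, h4⟩; exact ⟨h2, h4, h3⟩
  · rintro ⟨rfl, rfl, h⟩
    exact ⟨⟨fun x hx => Finset.mem_range.2 (lt_of_mem hx), rfl⟩, h, rfl⟩

lemma Fnum_eq_card {k l n M : ℕ} (h : 2 ^ k + 2 ^ l ≤ n) (hM : n ≤ M) :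
    Fnum k l n = ((oddSets M n).filter (fun X => op k (op l X) ≠ op l (op k X))).card := by
  have hcomp : ∀ X ∈ oddSets M n, ∀ a b : ℕ, 2 ^ a + 2 ^ b ≤ n →
      fkOp a (fkOp b (partOfBeta X)) = partOfBeta (op a (op b X)) ∧
        (op a (op b X)).card = M := by
    intro X hX a b hab
    obtain ⟨rfl, rfl, ho⟩ := mem_oddSets.1 hX
    have ha : 0 < 2 ^ a := by positivity
    have hb : 0 < 2 ^ b := by positivity
    obtain ⟨h1, h2⟩ := ho.op_spec (k := b) (by omega)
    have h3 := h1.sz_add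
    have h4 := h1.card_eq
    obtain ⟨h5, h6⟩ := h2.op_spec (k := a) (by omega)
    rw [fkOp_partOfBeta ho (by omega) hM, fkOp_partOfBeta h2 (by omega) (by omega)]
    exact ⟨rfl, h5.card_eq.trans h4⟩
  rw [← Set.ncard_coe_finset, ← Set.InjOn.ncard_image (f := partOfBeta), Fnum]
  · congr 1
    ext lam
    simp only [Set.mem_ofPred_eq, Set.mem_image, Finset.coe_filter]
    constructor
    · rintro ⟨h1, h2, h3⟩
      have hc : Multiset.card lam ≤ M := (card_le_sum_of_pos h1.1).trans (h2.le.trans hM)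
      have hp := partOfBeta_betaSet h1.1 hc
      have hmem : betaSet lam M ∈ oddSets M n := by
        rw [mem_oddSets, ← oddP_partOfBeta, ← sum_partOfBeta, hp]
        exact ⟨card_betaSet _ _, h2, h1⟩
      refine ⟨betaSet lam M, ⟨hmem, fun he => h3 ?_⟩, hp⟩
      rw [← hp, (hcomp _ hmem k l h).1, (hcomp _ hmem l k (by omega)).1, he]
    · rintro ⟨X, ⟨hX, hne⟩, rfl⟩
      obtain ⟨h1, h2⟩ := hcomp _ hX k l h
      obtain ⟨h3, h4⟩ := hcomp _ hX l k (by omega)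
      obtain ⟨hc, hs, ho⟩ := mem_oddSets.1 hX
      refine ⟨oddP_partOfBeta.2 ho, by rw [sum_partOfBeta, hs], ?_⟩
      rw [h1, h3]
      exact fun he => hne (eq_of_partOfBeta_eq (h2.trans h4.symm) he)
  · intro X hX Y hY he
    simp only [Finset.coe_filter, Set.mem_ofPred_eq, mem_oddSets] at hX hY
    exact eq_of_partOfBeta_eq (hX.1.1.trans hY.1.1.symm) he

/-- The beads on the `i`-th runner of the abacus with `G` runners. -/
def run (G i : ℕ) (X : Finset ℕ) : Finset ℕ := (X.filter (fun x => x % G = i)).image (· / G)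

/-- The bead set with prescribed runners. -/
def ofRuns (G : ℕ) (f : ℕ → Finset ℕ) : Finset ℕ :=
  (Finset.range G).biUnion (fun i => (f i).image (fun y => G * y + i))

/-- Push all beads down on their runners. -/
def core (G : ℕ) (X : Finset ℕ) : Finset ℕ := ofRuns G (fun i => Finset.range (run G i X).card)

lemma mem_run {G i y : ℕ} {X : Finset ℕ} (hi : i < G) : y ∈ run G i X ↔ G * y + i ∈ X := by
  simp only [run, Finset.mem_image, Finset.mem_filter]
  constructor
  · rintro ⟨x, ⟨hx, rfl⟩, rfl⟩
    rwa [Nat.div_add_mod]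
  · intro h
    refine ⟨_, ⟨h, ?_⟩, ?_⟩
    · rw [Nat.mul_add_mod, Nat.mod_eq_of_lt hi]
    · rw [Nat.mul_add_div (by omega), Nat.div_eq_of_lt hi, add_zero]

lemma mem_ofRuns {G x : ℕ} {f : ℕ → Finset ℕ} (hG : 0 < G) :
    x ∈ ofRuns G f ↔ x / G ∈ f (x % G) := by
  simp only [ofRuns, Finset.mem_biUnion, Finset.mem_image, Finset.mem_range]
  constructor
  · rintro ⟨i, hi, y, hy, rfl⟩
    rwa [Nat.mul_add_mod, Nat.mod_eq_of_lt hi, Nat.mul_add_div (by omega), Nat.div_eq_of_lt hi,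
      add_zero]
  · intro h
    exact ⟨_, Nat.mod_lt _ hG, _, h, Nat.div_add_mod _ _⟩

lemma run_ofRuns {G i : ℕ} {f : ℕ → Finset ℕ} (hi : i < G) : run G i (ofRuns G f) = f i := by
  ext y
  rw [mem_run hi, mem_ofRuns (by omega), Nat.mul_add_mod, Nat.mod_eq_of_lt hi,
    Nat.mul_add_div (by omega), Nat.div_eq_of_lt hi, add_zero]

lemma eq_of_run_eq {G : ℕ} (hG : 0 < G) {X Y : Finset ℕ} (h : ∀ i < G, run G i X = run G i Y) :
    X = Y := by
  ext x
  have := h (x % G) (Nat.mod_lt _ hG)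
  rw [← Nat.div_add_mod x G, ← mem_run (Nat.mod_lt _ hG), this, mem_run (Nat.mod_lt _ hG)]

lemma ofRuns_run {G : ℕ} (hG : 0 < G) (X : Finset ℕ) : ofRuns G (fun i => run G i X) = X :=
  eq_of_run_eq hG fun _ hi => run_ofRuns hi

lemma sum_ofRuns (G : ℕ) (f : ℕ → Finset ℕ) (g : ℕ → ℕ) :
    ∑ x ∈ ofRuns G f, g x = ∑ i ∈ Finset.range G, ∑ y ∈ f i, g (G * y + i) := by
  rw [ofRuns, Finset.sum_biUnion]
  · refine Finset.sum_congr rfl fun i hi => ?_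
    rw [Finset.mem_range] at hi
    rw [Finset.sum_image]
    intro a _ b _ h
    simp only [add_left_inj] at h
    exact Nat.eq_of_mul_eq_mul_left (by omega) h
  · intro i hi j hj hij
    simp only [Finset.coe_range, Set.mem_Iio] at hi hj
    refine Finset.disjoint_left.2 fun x hx hx' => hij ?_
    obtain ⟨a, -, rfl⟩ := Finset.mem_image.1 hx
    obtain ⟨b, -, h⟩ := Finset.mem_image.1 hx'
    have := congrArg (· % G) h
    simp only [Nat.mul_add_mod, Nat.mod_eq_of_lt hi, Nat.mod_eq_of_lt hj] at this
    exact this.symm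

lemma card_eq_sum_run {G : ℕ} (hG : 0 < G) (X : Finset ℕ) :
    X.card = ∑ i ∈ Finset.range G, (run G i X).card := by
  conv_lhs => rw [← ofRuns_run hG X, Finset.card_eq_sum_ones, sum_ofRuns]
  simp

lemma run_core {G i : ℕ} {X : Finset ℕ} (hi : i < G) :
    run G i (core G X) = Finset.range (run G i X).card := run_ofRuns hi

lemma card_core {G : ℕ} (hG : 0 < G) (X : Finset ℕ) : (core G X).card = X.card := by
  rw [card_eq_sum_run hG, card_eq_sum_run hG X]
  refine Finset.sum_congr rfl fun i hi => ?_
  rw [run_core (Finset.mem_range.1 hi), Finset.card_range]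

lemma sz_eq_core_add {G : ℕ} (hG : 0 < G) (X : Finset ℕ) :
    sz X = sz (core G X) + G * ∑ i ∈ Finset.range G, sz (run G i X) := by
  have key : ∀ Z : Finset ℕ, ∑ x ∈ Z, x = ∑ i ∈ Finset.range G,
      (G * sz (run G i Z) + (G * (∑ j ∈ Finset.range (run G i Z).card, j) +
        (run G i Z).card * i)) := by
    intro Z
    conv_lhs => rw [← ofRuns_run hG Z, sum_ofRuns]
    refine Finset.sum_congr rfl fun i _ => ?_
    rw [Finset.sum_add_distrib, ← Finset.mul_sum, sum_eq_sz_add]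
    simp only [Finset.sum_const, smul_eq_mul]
    ring
  have h1 := key X
  have h2 := key (core G X)
  rw [sum_eq_sz_add, Finset.sum_add_distrib, ← Finset.mul_sum] at h1 h2
  rw [card_core hG] at h2
  have h3 : ∑ i ∈ Finset.range G, sz (run G i (core G X)) = 0 :=
    Finset.sum_eq_zero fun i hi => by rw [run_core (Finset.mem_range.1 hi), sz_range]
  rw [h3] at h2
  have h4 : ∑ i ∈ Finset.range G, (G * (∑ j ∈ Finset.range (run G i (core G X)).card, j) +
        (run G i (core G X)).card * i) =
      ∑ i ∈ Finset.range G, (G * (∑ j ∈ Finset.range (run G i X).card, j) +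
        (run G i X).card * i) :=
    Finset.sum_congr rfl fun i hi => by
      rw [run_core (Finset.mem_range.1 hi), Finset.card_range]
  omega

lemma isChild_iff_run {G e : ℕ} (hG : 0 < G) {X Y : Finset ℕ} :
    IsChild (G * e) X Y ↔ ∃ i < G, IsChild e (run G i X) (run G i Y) ∧
      ∀ j < G, j ≠ i → run G j Y = run G j X := by
  have key : ∀ i < G, ∀ y, (G * y + i ∈ movable (G * e) X ↔ y ∈ movable e (run G i X)) ∧
      (e ≤ y → run G i (move (G * e) X (G * y + i)) = move e (run G i X) y ∧
        ∀ j < G, j ≠ i → run G j (move (G * e) X (G * y + i)) = run G j X) := by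
    intro i hi y
    have hle : G * e ≤ G * y + i ↔ e ≤ y := by
      constructor
      · intro h
        by_contra hc
        have : G * (y + 1) ≤ G * e := Nat.mul_le_mul_left G (by omega)
        rw [Nat.mul_add] at this; omega
      · intro h
        have := Nat.mul_le_mul_left G h
        omega
    have hsub : e ≤ y → G * y + i - G * e = G * (y - e) + i := by
      intro h
      have := Nat.mul_le_mul_left G h
      rw [Nat.mul_sub]; omega
    have hinj : ∀ j < G, ∀ a b, G * a + j = G * b + i ↔ a = b ∧ j = i := by
      intro j hj a b
      constructor
      · intro h
        have h1 := congrArg (· % G) h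
        have h2 := congrArg (· / G) h
        simp only [Nat.mul_add_mod, Nat.mod_eq_of_lt hi, Nat.mod_eq_of_lt hj,
          Nat.mul_add_div hG, Nat.div_eq_of_lt hi, Nat.div_eq_of_lt hj, add_zero] at h1 h2
        exact ⟨h2, h1⟩
      · rintro ⟨rfl, rfl⟩; rfl
    refine ⟨?_, fun h => ⟨?_, fun j hj hji => ?_⟩⟩
    · rw [mem_movable, mem_movable, mem_run hi, mem_run hi, hle]
      constructor
      · rintro ⟨h1, h2, h3⟩; rw [hsub h2] at h3; exact ⟨h1, h2, h3⟩
      · rintro ⟨h1, h2, h3⟩; rw [hsub h2]; exact ⟨h1, h2, h3⟩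
    · ext z
      rw [mem_run hi, mem_move, mem_move, mem_run hi, hsub h, hinj i hi, Ne, hinj i hi]
      simp
    · ext z
      rw [mem_run hj, mem_move, mem_run hj, hsub h, hinj j hj, Ne, hinj j hj]
      simp [hji]
  constructor
  · rintro ⟨x, hx, rfl⟩
    have hi := Nat.mod_lt x hG
    rw [← Nat.div_add_mod x G] at hx ⊢
    obtain ⟨h1, h2⟩ := key _ hi (x / G)
    obtain ⟨h3, h4⟩ := h2 (mem_movable.1 (h1.1 hx)).2.1
    exact ⟨_, hi, ⟨_, h1.1 hx, h3⟩, h4⟩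
  · rintro ⟨i, hi, ⟨y, hy, h⟩, h'⟩
    obtain ⟨h1, h2⟩ := key i hi y
    obtain ⟨h3, h4⟩ := h2 (mem_movable.1 hy).2.1
    refine ⟨_, h1.2 hy, eq_of_run_eq hG fun j hj => ?_⟩
    by_cases hji : j = i
    · subst hji; rw [h, h3]
    · rw [h' j hj hji, h4 j hj hji]

lemma core_eq_of_isChild {G e : ℕ} (hG : 0 < G) {X Y : Finset ℕ} (h : IsChild (G * e) X Y) :
    core G Y = core G X := by
  obtain ⟨i, hi, h1, h2⟩ := (isChild_iff_run hG).1 h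
  refine eq_of_run_eq hG fun j hj => ?_
  rw [run_core hj, run_core hj]
  by_cases hji : j = i
  · rw [hji, h1.card_eq]
  · rw [h2 j hj hji]

/-- Each element `b` of `B` is assigned a runner `c b` such that all runners are odd, of sizes
given by the elements of `B` assigned to them. -/
structure IsDatum (G : ℕ) (X B : Finset ℕ) (c : ℕ → ℕ) : Prop where
  lt : ∀ b ∈ B, c b < G
  odd_run : ∀ i < G, OddB (run G i X)
  sz_run : ∀ i < G, sz (run G i X) = ∑ b ∈ B with c b = i, 2 ^ b

lemma sum_filter_lt {B : Finset ℕ} {t : ℕ} (hB : ∀ b ∈ B, b < t) (c : ℕ → ℕ) (i : ℕ) :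
    ∑ b ∈ B with c b = i, 2 ^ b < 2 ^ t :=
  Nat.geomSum_lt le_rfl fun b hb => hB b (Finset.mem_filter.1 hb).1

/-- Macdonald's description of the odd partitions, on the abacus with `2 ^ k` runners. -/
lemma oddB_iff_exists_datum {k m : ℕ} (hm : m < 2 ^ k) {X B : Finset ℕ}
    (hX : sz X = m + 2 ^ k * ∑ b ∈ B, 2 ^ b) :
    OddB X ↔ OddB (core (2 ^ k) X) ∧ ∃ c, IsDatum (2 ^ k) X B c := by
  have hG : 0 < 2 ^ k := by positivity
  induction B using Finset.induction_on_max generalizing X with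
  | empty =>
    have h0 := sz_eq_core_add hG X
    rw [hX] at h0
    have h1 : ∑ i ∈ Finset.range (2 ^ k), sz (run (2 ^ k) i X) = 0 := by
      by_contra hne
      have := Nat.mul_le_mul_left (2 ^ k) (Nat.one_le_iff_ne_zero.2 hne)
      simp only [Finset.sum_empty, mul_zero, mul_one] at h0 this
      omega
    have h2 : ∀ i < 2 ^ k, sz (run (2 ^ k) i X) = 0 := fun i hi =>
      (Finset.sum_eq_zero_iff.1 h1) i (Finset.mem_range.2 hi)
    have h3 : core (2 ^ k) X = X := eq_of_run_eq hG fun i hi => by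
      rw [run_core hi, ← eq_range_of_sz_eq_zero (h2 i hi)]
    rw [h3]
    exact ⟨fun h => ⟨h, fun _ => 0, by simp, fun i hi => oddB_of_sz_eq_zero (h2 i hi),
      fun i hi => by rw [h2 i hi]; simp⟩, fun h => h.1⟩
  | insert t B ht ih =>
    have htB : t ∉ B := fun h => lt_irrefl _ (ht t h)
    rw [Finset.sum_insert htB, mul_add] at hX
    have hlt : ∑ b ∈ B, 2 ^ b < 2 ^ t := Nat.geomSum_lt le_rfl ht
    have hlt' : m + 2 ^ k * ∑ b ∈ B, 2 ^ b < 2 ^ k * 2 ^ t := by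
      have := Nat.mul_le_mul_left (2 ^ k) (Nat.succ_le_of_lt hlt)
      rw [Nat.mul_succ] at this; omega
    have hsum : ∀ (c : ℕ → ℕ) (i : ℕ), ∑ b ∈ insert t B with c b = i, 2 ^ b =
        (if c t = i then 2 ^ t else 0) + ∑ b ∈ B with c b = i, 2 ^ b := by
      intro c i
      rw [Finset.sum_filter, Finset.sum_insert htB, Finset.sum_filter]
    rw [oddB_iff_exists_child (t := k + t) (by rw [pow_add]; omega) (by rw [pow_add]; omega),
      pow_add]
    constructor
    · rintro ⟨Y, hXY, hY⟩
      have hsz := hXY.sz_add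
      obtain ⟨h1, c, hc⟩ := (ih (X := Y) (by omega)).1 hY
      rw [core_eq_of_isChild hG hXY] at h1
      obtain ⟨i, hi, h2, h3⟩ := (isChild_iff_run hG).1 hXY
      have hupd : ∀ j, ∑ b ∈ B with Function.update c t i b = j, 2 ^ b =
          ∑ b ∈ B with c b = j, 2 ^ b := by
        intro j
        refine Finset.sum_congr (Finset.filter_congr fun b hb => ?_) fun _ _ => rfl
        rw [Function.update_of_ne (ne_of_mem_of_not_mem hb htB)]
      have hszi := h2.sz_add
      rw [hc.sz_run i hi] at hszi
      refine ⟨h1, Function.update c t i, ?_, ?_, ?_⟩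
      · intro b hb
        by_cases hbt : b = t
        · subst hbt; simpa using hi
        · rw [Function.update_of_ne hbt]
          exact hc.lt b ((Finset.mem_insert.1 hb).resolve_left hbt)
      · intro j hj
        by_cases hji : j = i
        · subst hji
          have := sum_filter_lt ht c j
          rw [oddB_iff_exists_child (t := t) (by omega) (by omega)]
          exact ⟨_, h2, hc.odd_run j hj⟩
        · rw [← h3 j hj hji]; exact hc.odd_run j hj
      · intro j hj
        rw [hsum, hupd, Function.update_self]
        by_cases hji : j = i
        · subst hji; rw [if_pos rfl]; omega
        · rw [if_neg (Ne.symm hji), ← h3 j hj hji, hc.sz_run j hj, zero_add]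
    · rintro ⟨h1, c, hc⟩
      have hi := hc.lt t (Finset.mem_insert_self _ _)
      have hszi := hc.sz_run _ hi
      rw [hsum, if_pos rfl] at hszi
      have := sum_filter_lt ht c (c t)
      obtain ⟨Z, hZ, hZo⟩ := (oddB_iff_exists_child (t := t) (by omega) (by omega)).1
        (hc.odd_run _ hi)
      let Y := ofRuns (2 ^ k) (Function.update (fun j => run (2 ^ k) j X) (c t) Z)
      have hYi : run (2 ^ k) (c t) Y = Z := by
        rw [run_ofRuns hi, Function.update_self]
      have hYj : ∀ j < 2 ^ k, j ≠ c t → run (2 ^ k) j Y = run (2 ^ k) j X := by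
        intro j hj hji
        rw [run_ofRuns hj, Function.update_of_ne hji]
      have hXY : IsChild (2 ^ k * 2 ^ t) X Y :=
        (isChild_iff_run hG).2 ⟨_, hi, hYi.symm ▸ hZ, hYj⟩
      have hsz := hXY.sz_add
      refine ⟨Y, hXY, (ih (X := Y) (by omega)).2 ⟨?_, c, ?_, ?_, ?_⟩⟩
      · rwa [core_eq_of_isChild hG hXY]
      · exact fun b hb => hc.lt b (Finset.mem_insert_of_mem hb)
      · intro j hj
        by_cases hji : j = c t
        · rw [hji, hYi]; exact hZo
        · rw [hYj j hj hji]; exact hc.odd_run j hj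
      · intro j hj
        by_cases hji : j = c t
        · have := hZ.sz_add
          rw [hji, hYi]; omega
        · rw [hYj j hj hji, hc.sz_run j hj, hsum, if_neg (Ne.symm hji), zero_add]

lemma sum_Ico_two_pow {d w : ℕ} (h : d ≤ w) : ∑ b ∈ Finset.Ico d w, 2 ^ b + 2 ^ d = 2 ^ w := by
  induction w, h using Nat.le_induction with
  | base => simp
  | succ w hw ih => rw [Finset.sum_Ico_succ_top hw, pow_succ]; omega

/-- The binary digits of `∑ b ∈ B, 2 ^ b - 2 ^ d`, where `w` is the least element of `B` which is
at least `d`. -/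
def borrow (B : Finset ℕ) (d w : ℕ) : Finset ℕ := B.erase w ∪ Finset.Ico d w

lemma mem_borrow {B : Finset ℕ} {d w b : ℕ} :
    b ∈ borrow B d w ↔ (b ≠ w ∧ b ∈ B) ∨ (d ≤ b ∧ b < w) := by
  simp [borrow]

lemma sum_borrow {B : Finset ℕ} {d w : ℕ} (hw : w ∈ B) (hdw : d ≤ w)
    (hmin : ∀ b ∈ B, d ≤ b → w ≤ b) : ∑ b ∈ borrow B d w, 2 ^ b + 2 ^ d = ∑ b ∈ B, 2 ^ b := by
  rw [borrow, Finset.sum_union, add_assoc, sum_Ico_two_pow hdw, Finset.sum_erase_add _ _ hw]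
  refine Finset.disjoint_left.2 fun b hb hb' => ?_
  have := hmin b (Finset.mem_of_mem_erase hb)
  rw [Finset.mem_Ico] at hb'
  omega

/-- The runners of the digits of `borrow B d w`. -/
def borrowRunner (c : ℕ → ℕ) (d w : ℕ) : ℕ → ℕ := fun b => if d ≤ b ∧ b < w then c w else c b

lemma OddB.op_datum {k m d w : ℕ} {X B : Finset ℕ} {c : ℕ → ℕ} (hX : OddB X) (hm : m < 2 ^ k)
    (hsz : sz X = m + 2 ^ k * ∑ b ∈ B, 2 ^ b) (hD : IsDatum (2 ^ k) X B c) (hw : w ∈ B)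
    (hdw : d ≤ w) (hmin : ∀ b ∈ B, d ≤ b → w ≤ b) :
    OddB (op (k + d) X) ∧
    sz (op (k + d) X) = m + 2 ^ k * ∑ b ∈ borrow B d w, 2 ^ b ∧
    IsDatum (2 ^ k) (op (k + d) X) (borrow B d w) (borrowRunner c d w) ∧
    ∀ j < 2 ^ k, run (2 ^ k) j (op (k + d) X) =
      if j = c w then op d (run (2 ^ k) j X) else run (2 ^ k) j X := by
  have hG : 0 < 2 ^ k := by positivity
  have hsb := sum_borrow hw hdw hmin
  have hle : 2 ^ (k + d) ≤ sz X := by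
    rw [hsz, ← hsb, pow_add, mul_add]; omega
  obtain ⟨hch, ho⟩ := hX.op_spec hle
  generalize op (k + d) X = Y at hch ho
  rw [pow_add] at hch
  have hszY : sz Y = m + 2 ^ k * ∑ b ∈ borrow B d w, 2 ^ b := by
    have := hch.sz_add
    rw [hsz, ← hsb, mul_add] at this
    omega
  obtain ⟨-, c', hc'⟩ := (oddB_iff_exists_datum hm hszY).1 ho
  obtain ⟨i, hi, h1, h2⟩ := (isChild_iff_run hG).1 hch
  have hi' : i = c w := by
    by_contra hne
    have h3 := h2 _ (hD.lt w hw) (Ne.symm hne)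
    have h4 := hc'.sz_run _ (hD.lt w hw)
    rw [h3, hD.sz_run _ (hD.lt w hw)] at h4
    have h5 := Finset.geomSum_injective le_rfl h4
    have h6 : w ∈ (borrow B d w).filter (fun b => c' b = c w) := by
      rw [← h5, Finset.mem_filter]; exact ⟨hw, rfl⟩
    have := (mem_borrow.1 (Finset.mem_filter.1 h6).1)
    omega
  subst hi'
  have h3 : run (2 ^ k) (c w) Y = op d (run (2 ^ k) (c w) X) :=
    (hD.odd_run _ hi).eq_op h1 (hc'.odd_run _ hi)
  refine ⟨ho, hszY, ⟨?_, hc'.odd_run, ?_⟩, ?_⟩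
  · intro b hb
    rw [mem_borrow] at hb
    unfold borrowRunner
    split
    · exact hi
    · exact hD.lt b (by tauto)
  · intro j hj
    by_cases hji : j = c w
    · subst hji
      have h4 := h1.sz_add
      rw [hD.sz_run _ hj] at h4
      have h5 : (borrow B d w).filter (fun b => borrowRunner c d w b = c w) =
          borrow (B.filter (fun b => c b = c w)) d w := by
        ext b
        rw [Finset.mem_filter, mem_borrow, mem_borrow, Finset.mem_filter, borrowRunner]
        by_cases hb : d ≤ b ∧ b < w
        · simp [hb]
        · simp [hb, and_assoc]
      have h6 := sum_borrow (B := B.filter (fun b => c b = c w)) (Finset.mem_filter.2 ⟨hw, rfl⟩)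
        hdw (fun b hb => hmin b (Finset.mem_filter.1 hb).1)
      rw [h5]; omega
    · rw [h2 j hj hji, hD.sz_run j hj]
      refine Finset.sum_congr ?_ fun _ _ => rfl
      ext b
      rw [Finset.mem_filter, Finset.mem_filter, mem_borrow, borrowRunner]
      by_cases hb : d ≤ b ∧ b < w
      · simp only [hb, and_self, or_true, if_true, true_and, Ne.symm hji, iff_false, not_and]
        intro hbB
        have := hmin b hbB hb.1
        omega
      · simp only [hb, or_false, if_false]
        constructor
        · rintro ⟨h, rfl⟩
          exact ⟨⟨by rintro rfl; exact hji rfl, h⟩, rfl⟩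
        · rintro ⟨⟨-, h⟩, h'⟩
          exact ⟨h, h'⟩
  · intro j hj
    by_cases hji : j = c w
    · rw [if_pos hji, hji, h3]
    · rw [if_neg hji, h2 j hj hji]

/-- The operations `op k` and `op (k + d)` both act on a single runner. -/
lemma OddB.op_comm_iff {k m d u w : ℕ} {X B : Finset ℕ} {c : ℕ → ℕ} (hX : OddB X)
    (hm : m < 2 ^ k) (hsz : sz X = m + 2 ^ k * ∑ b ∈ B, 2 ^ b) (hD : IsDatum (2 ^ k) X B c)
    (hu : u ∈ B) (humin : ∀ b ∈ B, u ≤ b) (hw : w ∈ B) (hdw : d ≤ w)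
    (hwmin : ∀ b ∈ B, d ≤ b → w ≤ b) (hud : u ≠ d) :
    op k (op (k + d) X) ≠ op (k + d) (op k X) ↔ c u = c w ∧
      op 0 (op d (run (2 ^ k) (c u) X)) ≠ op d (op 0 (run (2 ^ k) (c u) X)) := by
  have hG : 0 < 2 ^ k := by positivity
  obtain ⟨o1, s1, D1, r1⟩ := hX.op_datum (d := 0) hm hsz hD hu (Nat.zero_le _)
    (fun b hb _ => humin b hb)
  obtain ⟨o2, s2, D2, r2⟩ := hX.op_datum hm hsz hD hw hdw hwmin
  have hcu := hD.lt u hu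
  have hcw := hD.lt w hw
  rw [Nat.add_zero] at o1 s1 D1 r1
  have key : ∃ u' w', u' ∈ borrow B d w ∧ (∀ b ∈ borrow B d w, u' ≤ b) ∧ w' ∈ borrow B 0 u ∧
      d ≤ w' ∧ (∀ b ∈ borrow B 0 u, d ≤ b → w' ≤ b) ∧ borrowRunner c d w u' = c u ∧
      borrowRunner c 0 u w' = c w := by
    simp only [mem_borrow, borrowRunner]
    rcases lt_or_gt_of_ne hud with hud | hud
    · refine ⟨u, w, Or.inl ⟨by omega, hu⟩, ?_, Or.inl ⟨by omega, hw⟩, hdw, ?_, ?_, ?_⟩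
      · rintro b (h | h)
        · exact humin b h.2
        · omega
      · rintro b (h | h) hb
        · exact hwmin b h.2 hb
        · omega
      · rw [if_neg (by omega)]
      · rw [if_neg (by omega)]
    · have huw : u = w := le_antisymm (humin w hw) (hwmin u hu hud.le)
      subst huw
      refine ⟨d, d, Or.inr ⟨le_rfl, hud⟩, ?_, Or.inr ⟨Nat.zero_le _, hud⟩, le_rfl,
        fun b _ hb => hb, if_pos ⟨le_rfl, hud⟩, if_pos ⟨Nat.zero_le _, hud⟩⟩
      rintro b (h | h)
      · have := humin b h.2; omega
      · omega
  obtain ⟨u', w', hu', hu'min, hw', hdw', hw'min, hcu', hcw'⟩ := key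
  obtain ⟨-, -, -, r3⟩ := o1.op_datum hm s1 D1 hw' hdw' hw'min
  obtain ⟨-, -, -, r4⟩ := o2.op_datum (d := 0) hm s2 D2 hu' (Nat.zero_le _)
    (fun b hb _ => hu'min b hb)
  rw [Nat.add_zero] at r4
  rw [hcw'] at r3
  rw [hcu'] at r4
  by_cases hcc : c u = c w
  · simp only [hcc, true_and]
    rw [not_iff_not]
    constructor
    · intro h
      have h5 := r3 _ hcw
      rw [← h, r4 _ hcw, r1 _ hcw, r2 _ hcw] at h5
      simpa [hcc] using h5
    · intro h
      refine eq_of_run_eq hG fun j hj => ?_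
      rw [r4 j hj, r3 j hj, r1 j hj, r2 j hj, hcc]
      by_cases hji : j = c w
      · simpa [hji] using h
      · simp [hji]
  · simp only [hcc, false_and, iff_false, not_not]
    refine eq_of_run_eq hG fun j hj => ?_
    rw [r4 j hj, r3 j hj, r1 j hj, r2 j hj]
    by_cases hj1 : j = c u
    · have : j ≠ c w := hj1 ▸ hcc
      simp [hj1, hcc]
    · simp [hj1]

lemma OddB.op_comm_iff' {k m d w : ℕ} {X B : Finset ℕ} {c : ℕ → ℕ} (hX : OddB X)
    (hm : m < 2 ^ k) (hsz : sz X = m + 2 ^ k * ∑ b ∈ B, 2 ^ b) (hD : IsDatum (2 ^ k) X B c)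
    (hd0 : 0 < d) (hd : d ∈ B) (hdmin : ∀ b ∈ B, d ≤ b) (hw : w ∈ B) (hdw : d < w)
    (hwmin : ∀ b ∈ B, d < b → w ≤ b) :
    op k (op (k + d) X) ≠ op (k + d) (op k X) ↔ c d ≠ c w ∨
      op 0 (op d (run (2 ^ k) (c d) X)) ≠ op d (op 0 (run (2 ^ k) (c d) X)) := by
  have hG : 0 < 2 ^ k := by positivity
  obtain ⟨o1, s1, D1, r1⟩ := hX.op_datum (d := 0) hm hsz hD hd (Nat.zero_le _)
    (fun b hb _ => hdmin b hb)
  obtain ⟨o2, s2, D2, r2⟩ := hX.op_datum hm hsz hD hd le_rfl (fun b _ hb => hb)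
  have hcd := hD.lt d hd
  have hcw := hD.lt w hw
  rw [Nat.add_zero] at o1 s1 D1 r1
  have hw1 : w ∈ borrow B 0 d := mem_borrow.2 (Or.inl ⟨hdw.ne', hw⟩)
  have hw2 : w ∈ borrow B d d := mem_borrow.2 (Or.inl ⟨hdw.ne', hw⟩)
  obtain ⟨-, -, -, r3⟩ := o1.op_datum hm s1 D1 hw1 hdw.le (by
    intro b hb hdb
    rcases mem_borrow.1 hb with h | h
    · exact hwmin b h.2 (by omega)
    · omega)
  obtain ⟨-, -, -, r4⟩ := o2.op_datum (d := 0) hm s2 D2 hw2 (Nat.zero_le _) (by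
    intro b hb _
    rcases mem_borrow.1 hb with h | h
    · have := hdmin b h.2
      exact hwmin b h.2 (by omega)
    · omega)
  rw [Nat.add_zero] at r4
  rw [show borrowRunner c 0 d w = c w from if_neg (by omega)] at r3
  rw [show borrowRunner c d d w = c w from if_neg (by omega)] at r4
  by_cases hcc : c d = c w
  · simp only [hcc, ne_eq, not_true_eq_false, false_or]
    rw [not_iff_not]
    constructor
    · intro h
      have h5 := r3 _ hcw
      rw [← h, r4 _ hcw, r1 _ hcw, r2 _ hcw] at h5
      simpa [hcc] using h5
    · intro h
      refine eq_of_run_eq hG fun j hj => ?_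
      rw [r4 j hj, r3 j hj, r1 j hj, r2 j hj, hcc]
      by_cases hji : j = c w
      · simpa [hji] using h
      · simp [hji]
  · simp only [hcc, ne_eq, not_false_eq_true, true_or, iff_true]
    intro h
    have h5 := r3 _ hcd
    rw [← h, r4 _ hcd, r1 _ hcd, r2 _ hcd] at h5
    simp only [hcc, if_true, if_false] at h5
    have hle : 2 ^ d ≤ sz (run (2 ^ k) (c d) X) := by
      rw [hD.sz_run _ hcd]
      exact Finset.single_le_sum (f := fun b => 2 ^ b) (fun _ _ => Nat.zero_le _)
        (Finset.mem_filter.2 ⟨hd, rfl⟩)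
    have h1d : 2 ^ 0 < 2 ^ d := Nat.pow_lt_pow_right one_lt_two hd0
    have h6 := ((hD.odd_run _ hcd).op_spec hle).1.sz_add
    have h7 := ((hD.odd_run _ hcd).op_spec (h1d.le.trans hle)).1.sz_add
    rw [h5] at h6
    omega

/-- The elements of `B` assigned to the runner `i`. -/
noncomputable def digits {B : Finset ℕ} {G : ℕ} (c : B → Fin G) (i : Fin G) : Finset ℕ :=
  (Finset.univ.filter (fun b => c b = i)).map (Function.Embedding.subtype _)

/-- Extend an assignment of runners by zero. -/
noncomputable def extend {B : Finset ℕ} {G : ℕ} (c : B → Fin G) (b : ℕ) : ℕ :=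
  if h : b ∈ B then c ⟨b, h⟩ else 0

/-- The bead set with runners given by a function on `Fin G`. -/
noncomputable def ofFinRuns {G : ℕ} (Y : Fin G → Finset ℕ) : Finset ℕ :=
  ofRuns G (fun j => if h : j < G then Y ⟨j, h⟩ else ∅)

section
variable {B : Finset ℕ} {G : ℕ}

lemma mem_digits {c : B → Fin G} {i : Fin G} {b : ℕ} :
    b ∈ digits c i ↔ ∃ h : b ∈ B, c ⟨b, h⟩ = i := by
  simp [digits]

lemma extend_apply {c : B → Fin G} {b : ℕ} (h : b ∈ B) : extend c b = c ⟨b, h⟩ := dif_pos h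

lemma digits_eq_filter (c : B → Fin G) (i : Fin G) :
    digits c i = B.filter (fun b => extend c b = i) := by
  ext b
  rw [mem_digits, Finset.mem_filter]
  constructor
  · rintro ⟨h, rfl⟩; exact ⟨h, extend_apply h⟩
  · rintro ⟨h, h'⟩
    rw [extend_apply h] at h'
    exact ⟨h, Fin.ext h'⟩

lemma digits_subset (c : B → Fin G) (i : Fin G) : digits c i ⊆ B := by
  rw [digits_eq_filter]; exact Finset.filter_subset _ _

lemma run_ofFinRuns (Y : Fin G → Finset ℕ) (i : Fin G) : run G i (ofFinRuns Y) = Y i := by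
  rw [ofFinRuns, run_ofRuns i.2, dif_pos i.2]

lemma core_eq_self {m : ℕ} {C : Finset ℕ} (hm : m < G) (hC : sz C = m) :
    core G C = C ∧ ∀ i < G, run G i C = Finset.range (run G i C).card := by
  have hG : 0 < G := by omega
  have h0 := sz_eq_core_add hG C
  have h1 : ∑ i ∈ Finset.range G, sz (run G i C) = 0 := by
    by_contra hne
    have := Nat.mul_le_mul_left G (Nat.one_le_iff_ne_zero.2 hne)
    rw [mul_one] at this
    omega
  have h2 : ∀ i < G, run G i C = Finset.range (run G i C).card := fun i hi =>
    eq_range_of_sz_eq_zero (Finset.sum_eq_zero_iff.1 h1 i (Finset.mem_range.2 hi))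
  exact ⟨eq_of_run_eq hG fun i hi => by rw [run_core hi, ← h2 i hi], h2⟩

end

lemma ofFinRuns_spec {k m M : ℕ} (hm : m < 2 ^ k) {B C : Finset ℕ} {c : B → Fin (2 ^ k)}
    {Y : Fin (2 ^ k) → Finset ℕ} (hC : C ∈ oddSets M m)
    (hY : ∀ i : Fin (2 ^ k), Y i ∈ oddSets (run (2 ^ k) i C).card (∑ b ∈ digits c i, 2 ^ b)) :
    ofFinRuns Y ∈ oddSets M (m + 2 ^ k * ∑ b ∈ B, 2 ^ b) ∧ core (2 ^ k) (ofFinRuns Y) = C ∧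
      IsDatum (2 ^ k) (ofFinRuns Y) B (extend c) := by
  have hG : 0 < 2 ^ k := by positivity
  obtain ⟨hC1, hC2, hC3⟩ := mem_oddSets.1 hC
  have hrun : ∀ i (hi : i < 2 ^ k), run (2 ^ k) i (ofFinRuns Y) = Y ⟨i, hi⟩ := fun i hi =>
    run_ofFinRuns Y ⟨i, hi⟩
  have hc : core (2 ^ k) (ofFinRuns Y) = C := by
    refine eq_of_run_eq hG fun i hi => ?_
    rw [run_core hi, (core_eq_self hm hC2).2 i hi, hrun i hi, (mem_oddSets.1 (hY ⟨i, hi⟩)).1]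
  have hdat : IsDatum (2 ^ k) (ofFinRuns Y) B (extend c) := by
    refine ⟨fun b hb => by rw [extend_apply hb]; exact (c _).2, fun i hi => ?_, fun i hi => ?_⟩
    · rw [hrun i hi]; exact (mem_oddSets.1 (hY ⟨i, hi⟩)).2.2
    · rw [hrun i hi, (mem_oddSets.1 (hY ⟨i, hi⟩)).2.1, digits_eq_filter]
  have hsz : sz (ofFinRuns Y) = m + 2 ^ k * ∑ b ∈ B, 2 ^ b := by
    rw [sz_eq_core_add hG, hc, hC2]
    congr 2
    rw [← Finset.sum_fiberwise_of_maps_to (t := Finset.range (2 ^ k)) (g := extend c)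
      (fun b hb => Finset.mem_range.2 (hdat.lt b hb))]
    exact Finset.sum_congr rfl fun i hi => hdat.sz_run i (Finset.mem_range.1 hi)
  refine ⟨mem_oddSets.2 ⟨?_, hsz, ?_⟩, hc, hdat⟩
  · rw [← card_core hG, hc, hC1]
  · rw [oddB_iff_exists_datum hm hsz, hc]
    exact ⟨hC3, _, hdat⟩

/-- Odd bead sets are determined by their core, an assignment of binary digits to runners, and
odd bead sets on the runners. -/
lemma card_filter_oddSets {k m M : ℕ} (hm : m < 2 ^ k) (B : Finset ℕ) (Q : Finset ℕ → Prop) :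
    ((oddSets M (m + 2 ^ k * ∑ b ∈ B, 2 ^ b)).filter Q).card =
      ∑ C ∈ oddSets M m, ∑ c : B → Fin (2 ^ k),
        ((Fintype.piFinset fun i : Fin (2 ^ k) =>
          oddSets (run (2 ^ k) i C).card (∑ b ∈ digits c i, 2 ^ b)).filter
            (fun Y => Q (ofFinRuns Y))).card := by
  have hG : 0 < 2 ^ k := by positivity
  rw [← Finset.sum_product', ← Finset.card_sigma]
  symm
  have hmem : ∀ (C : Finset ℕ) (c : B → Fin (2 ^ k)) (Y : Fin (2 ^ k) → Finset ℕ),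
      (⟨(C, c), Y⟩ : Sigma fun _ : Finset ℕ × (B → Fin (2 ^ k)) => Fin (2 ^ k) → Finset ℕ) ∈
        ((oddSets M m ×ˢ Finset.univ).sigma fun x =>
          (Fintype.piFinset fun i : Fin (2 ^ k) => oddSets (run (2 ^ k) i x.1).card
            (∑ b ∈ digits x.2 i, 2 ^ b)).filter (fun Y => Q (ofFinRuns Y))) ↔
      C ∈ oddSets M m ∧ (∀ i : Fin (2 ^ k), Y i ∈ oddSets (run (2 ^ k) i C).card
            (∑ b ∈ digits c i, 2 ^ b)) ∧ Q (ofFinRuns Y) := by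
    intro C c Y
    simp only [Finset.mem_sigma, Finset.mem_product, Finset.mem_univ, and_true, Finset.mem_filter,
      Fintype.mem_piFinset]
  refine Finset.card_bij (fun x _ => ofFinRuns x.2) ?_ ?_ ?_
  · rintro ⟨⟨C, c⟩, Y⟩ hx
    rw [hmem] at hx
    obtain ⟨hC, hY, hQ⟩ := hx
    obtain ⟨h1, -, -⟩ := ofFinRuns_spec hm hC hY
    exact Finset.mem_filter.2 ⟨h1, hQ⟩
  · rintro ⟨⟨C, c⟩, Y⟩ hx ⟨⟨C', c'⟩, Y'⟩ hx' h
    rw [hmem] at hx hx'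
    simp only at h
    have hYY : Y = Y' := funext fun i => by rw [← run_ofFinRuns Y, h, run_ofFinRuns]
    subst hYY
    have hCC : C = C' := by
      rw [← (ofFinRuns_spec hm hx.1 hx.2.1).2.1, ← (ofFinRuns_spec hm hx'.1 hx'.2.1).2.1]
    subst hCC
    have hcc : c = c' := by
      funext b
      have h1 := (mem_oddSets.1 (hx.2.1 (c b))).2.1
      rw [(mem_oddSets.1 (hx'.2.1 (c b))).2.1] at h1
      have h2 := Finset.geomSum_injective le_rfl h1
      have h3 : (b : ℕ) ∈ digits c (c b) := mem_digits.2 ⟨b.2, rfl⟩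
      rw [← h2, mem_digits] at h3
      exact h3.2.symm
    rw [hcc]
  · intro X hX
    rw [Finset.mem_filter, mem_oddSets] at hX
    obtain ⟨⟨h1, h2, h3⟩, hQ⟩ := hX
    obtain ⟨h4, c, hc⟩ := (oddB_iff_exists_datum hm h2).1 h3
    have hX : ofFinRuns (fun i : Fin (2 ^ k) => run (2 ^ k) i X) = X := by
      refine eq_of_run_eq hG fun i hi => ?_
      exact run_ofFinRuns (fun i : Fin (2 ^ k) => run (2 ^ k) i X) ⟨i, hi⟩
    refine ⟨⟨(core (2 ^ k) X, fun b => ⟨c b, hc.lt b b.2⟩),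
      fun i => run (2 ^ k) i X⟩, ?_, hX⟩
    rw [hmem, mem_oddSets, hX]
    refine ⟨⟨?_, ?_, h4⟩, fun i => ?_, hQ⟩
    · rw [card_core hG, h1]
    · have h5 := sz_eq_core_add hG X
      have h6 : ∑ i ∈ Finset.range (2 ^ k), sz (run (2 ^ k) i X) = ∑ b ∈ B, 2 ^ b := by
        rw [← Finset.sum_fiberwise_of_maps_to (t := Finset.range (2 ^ k)) (g := c)
          (fun b hb => Finset.mem_range.2 (hc.lt b hb))]
        exact Finset.sum_congr rfl fun i hi => hc.sz_run i (Finset.mem_range.1 hi)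
      rw [h6] at h5
      omega
    · rw [mem_oddSets, run_core i.2, Finset.card_range]
      refine ⟨rfl, ?_, hc.odd_run i i.2⟩
      rw [hc.sz_run i i.2, digits_eq_filter]
      refine Finset.sum_congr (Finset.filter_congr fun b hb => ?_) fun _ _ => rfl
      rw [extend_apply hb]

lemma oddSets_zero (M : ℕ) : oddSets M 0 = {Finset.range M} := by
  ext X
  rw [mem_oddSets, Finset.mem_singleton]
  constructor
  · rintro ⟨rfl, h, -⟩; exact eq_range_of_sz_eq_zero h
  · rintro rfl
    exact ⟨Finset.card_range M, sz_range M, oddB_of_sz_eq_zero (sz_range M)⟩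

lemma card_oddSets_one {M : ℕ} (hM : 0 < M) : (oddSets M 1).card = 1 := by
  rw [Finset.card_eq_one]
  refine ⟨insert M (Finset.range (M - 1)), ?_⟩
  ext X
  rw [mem_oddSets, Finset.mem_singleton]
  constructor
  · rintro ⟨rfl, h, ho⟩
    obtain ⟨Y, ⟨x, hx, hY⟩, -⟩ := (oddB_iff_exists_child (t := 0) (by omega) (by omega)).1 ho
    rw [pow_zero] at hx hY
    have h1 := sz_move hx
    have h2 := eq_range_of_sz_eq_zero (X := move 1 X x) (by omega)
    rw [card_move hx] at h2
    rw [mem_movable] at hx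
    obtain ⟨h3, h4, h5⟩ := hx
    have key : ∀ y, (y = x - 1 ∨ y ≠ x ∧ y ∈ X) ↔ y < X.card := by
      intro y
      rw [← Finset.mem_range, ← h2, mem_move]
    have h6 : x - 1 < X.card := (key _).1 (Or.inl rfl)
    have h7 : ¬ x < X.card := fun h => by
      rcases (key x).2 h with h | h
      · omega
      · exact h.1 rfl
    have h8 : x = X.card := by omega
    ext y
    rw [Finset.mem_insert, Finset.mem_range, ← h8]
    have h9 := key y
    by_cases hy : y = x
    · simp [hy, h3]
    by_cases hy' : y = x - 1
    · simp [hy', h5]; omega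
    · have h10 : y ∈ X ↔ y < X.card := by rw [← h9]; tauto
      rw [h10]
      omega
  · rintro rfl
    have h1 : M ∈ movable 1 (insert M (Finset.range (M - 1))) := by
      rw [mem_movable]; simp; omega
    have h2 : move 1 (insert M (Finset.range (M - 1))) M = Finset.range M := by
      ext y
      simp only [mem_move, Finset.mem_insert, Finset.mem_range]
      omega
    have h3 := sz_move h1
    rw [h2, sz_range] at h3
    refine ⟨?_, by omega, ?_⟩
    · rw [← card_move h1, h2, Finset.card_range]
    · rw [oddB_iff_exists_child (t := 0) (by omega) (by omega)]
      exact ⟨_, ⟨M, h1, rfl⟩, h2 ▸ oddB_of_sz_eq_zero (sz_range M)⟩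

lemma le_card_run {k m s M : ℕ} {C : Finset ℕ} (hC : C ∈ oddSets M m) (hM : m + 2 ^ k * s ≤ M)
    (i : Fin (2 ^ k)) : s ≤ (run (2 ^ k) i C).card := by
  obtain ⟨h1, h2, -⟩ := mem_oddSets.1 hC
  have h3 : Finset.range (2 ^ k * s) ⊆ C := range_subset_of_sz (by omega)
  have h4 : Finset.range s ⊆ run (2 ^ k) i C := by
    intro y hy
    rw [Finset.mem_range] at hy
    rw [mem_run i.2]
    refine h3 (Finset.mem_range.2 ?_)
    have := Nat.mul_le_mul_left (2 ^ k) (Nat.succ_le_of_lt hy)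
    rw [Nat.mul_succ] at this
    omega
  simpa using Finset.card_le_card h4

/-- Macdonald's count of the odd partitions. -/
lemma card_oddSets {M : ℕ} {S : Finset ℕ} (hM : ∑ b ∈ S, 2 ^ b ≤ M) :
    (oddSets M (∑ b ∈ S, 2 ^ b)).card = ∏ b ∈ S, 2 ^ b := by
  induction S using Finset.induction_on_max with
  | empty => simp [oddSets_zero]
  | insert t S ht ih =>
    have htS : t ∉ S := fun h => lt_irrefl _ (ht t h)
    have hm : ∑ b ∈ S, 2 ^ b < 2 ^ t := Nat.geomSum_lt le_rfl ht
    rw [Finset.sum_insert htS] at hM ⊢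
    have h := card_filter_oddSets (M := M) hm {0} (fun _ => True)
    simp only [Finset.filter_true, Fintype.card_piFinset, Finset.sum_singleton, pow_zero,
      mul_one] at h
    rw [add_comm, h, Finset.prod_insert htS, ← ih (by omega), mul_comm, ← smul_eq_mul,
      ← Finset.sum_const]
    refine Finset.sum_congr rfl fun C hC => ?_
    have hone : ∀ c : ({0} : Finset ℕ) → Fin (2 ^ t), (∏ i : Fin (2 ^ t),
        (oddSets (run (2 ^ t) i C).card (∑ b ∈ digits c i, 2 ^ b)).card) = 1 := by
      intro c
      refine Finset.prod_eq_one fun i _ => ?_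
      have hs : digits c i ⊆ {0} := digits_subset c i
      rcases Finset.subset_singleton_iff.1 hs with h | h
      · rw [h, Finset.sum_empty, oddSets_zero, Finset.card_singleton]
      · rw [h, Finset.sum_singleton, pow_zero, card_oddSets_one]
        have := le_card_run (s := 1) hC (by omega) i
        omega
    rw [Finset.sum_congr rfl fun c _ => hone c]
    simp

lemma prod_digits {B : Finset ℕ} {G : ℕ} (c : B → Fin G) (i : Fin G) (g : ℕ → ℕ) :
    ∏ j ∈ Finset.univ.erase i, ∏ b ∈ digits c j, g b = ∏ b ∈ B \ digits c i, g b := by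
  rw [← Finset.prod_biUnion]
  · congr 1
    ext b
    simp only [Finset.mem_biUnion, Finset.mem_erase, Finset.mem_univ, and_true, Finset.mem_sdiff,
      mem_digits, not_exists]
    constructor
    · rintro ⟨j, hj, h, rfl⟩
      exact ⟨h, fun _ => hj⟩
    · rintro ⟨h, h'⟩
      exact ⟨_, h' h, h, rfl⟩
  · intro j _ j' _ hjj
    refine Finset.disjoint_left.2 fun b hb hb' => hjj ?_
    obtain ⟨h, rfl⟩ := mem_digits.1 hb
    obtain ⟨_, h⟩ := mem_digits.1 hb'
    exact h

lemma sum_digits_le {B : Finset ℕ} {G : ℕ} (c : B → Fin G) (i : Fin G) :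
    ∑ b ∈ digits c i, 2 ^ b ≤ ∑ b ∈ B, 2 ^ b :=
  Finset.sum_le_sum_of_subset (digits_subset c i)

lemma card_filter_runs {k m M : ℕ} {B C : Finset ℕ} (hC : C ∈ oddSets M m)
    (hM : m + 2 ^ k * ∑ b ∈ B, 2 ^ b ≤ M) (c : B → Fin (2 ^ k)) (i : Fin (2 ^ k))
    (R : Finset ℕ → Prop) :
    ((Fintype.piFinset fun i : Fin (2 ^ k) =>
      oddSets (run (2 ^ k) i C).card (∑ b ∈ digits c i, 2 ^ b)).filter (fun Y => R (Y i))).card =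
    ((oddSets (run (2 ^ k) i C).card (∑ b ∈ digits c i, 2 ^ b)).filter R).card *
      ∏ b ∈ B \ digits c i, 2 ^ b := by
  have h : (Fintype.piFinset fun i : Fin (2 ^ k) =>
      oddSets (run (2 ^ k) i C).card (∑ b ∈ digits c i, 2 ^ b)).filter (fun Y => R (Y i)) =
      Fintype.piFinset fun j : Fin (2 ^ k) => if j = i then
        (oddSets (run (2 ^ k) i C).card (∑ b ∈ digits c i, 2 ^ b)).filter R else
        oddSets (run (2 ^ k) j C).card (∑ b ∈ digits c j, 2 ^ b) := by
    ext Y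
    simp only [Finset.mem_filter, Fintype.mem_piFinset]
    constructor
    · rintro ⟨h1, h2⟩ j
      by_cases hj : j = i
      · subst hj
        rw [if_pos rfl, Finset.mem_filter]
        exact ⟨h1 j, h2⟩
      · rw [if_neg hj]; exact h1 j
    · intro h
      have hi := h i
      rw [if_pos rfl, Finset.mem_filter] at hi
      refine ⟨fun j => ?_, hi.2⟩
      by_cases hj : j = i
      · subst hj; exact hi.1
      · have := h j
        rwa [if_neg hj] at this
  rw [h, Fintype.card_piFinset, ← Finset.mul_prod_erase _ _ (Finset.mem_univ i), if_pos rfl,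
    ← prod_digits]
  congr 1
  refine Finset.prod_congr rfl fun j hj => ?_
  rw [if_neg (Finset.ne_of_mem_erase hj), card_oddSets]
  exact (sum_digits_le c j).trans (le_card_run hC hM j)

lemma card_runs {k m M : ℕ} {B C : Finset ℕ} (hC : C ∈ oddSets M m)
    (hM : m + 2 ^ k * ∑ b ∈ B, 2 ^ b ≤ M) (c : B → Fin (2 ^ k)) :
    (Fintype.piFinset fun i : Fin (2 ^ k) =>
      oddSets (run (2 ^ k) i C).card (∑ b ∈ digits c i, 2 ^ b)).card = ∏ b ∈ B, 2 ^ b := by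
  have hG : 0 < 2 ^ k := by positivity
  have h := card_filter_runs hC hM c ⟨0, hG⟩ (fun _ => True)
  simp only [Finset.filter_true] at h
  rw [h, card_oddSets, mul_comm, Finset.prod_sdiff (digits_subset c _)]
  exact (sum_digits_le c _).trans (le_card_run hC hM ⟨0, hG⟩)

/-- The number of assignments with a prescribed set of digits on the runner `i`. -/
lemma card_filter_digits_eq {B J : Finset ℕ} (hJ : J ⊆ B) {G : ℕ} (i : Fin G) :
    (Finset.univ.filter (fun c : B → Fin G => digits c i = J)).card =
      (G - 1) ^ (B \ J).card := by
  have h : Finset.univ.filter (fun c : B → Fin G => digits c i = J) =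
      Fintype.piFinset (fun b : B => if (b : ℕ) ∈ J then {i} else Finset.univ.erase i) := by
    ext c
    simp only [Finset.mem_filter, Finset.mem_univ, true_and, Fintype.mem_piFinset]
    constructor
    · rintro rfl b
      have : (b : ℕ) ∈ digits c i ↔ c b = i := by
        rw [mem_digits]; simp
      split
      · rw [Finset.mem_singleton]; tauto
      · rw [Finset.mem_erase]; exact ⟨by tauto, Finset.mem_univ _⟩
    · intro h
      ext b
      rw [mem_digits]
      constructor
      · rintro ⟨hb, hc⟩
        by_contra hbJ
        have := h ⟨b, hb⟩
        rw [if_neg hbJ, Finset.mem_erase] at this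
        exact this.1 hc
      · intro hb
        have := h ⟨b, hJ hb⟩
        rw [if_pos hb, Finset.mem_singleton] at this
        exact ⟨hJ hb, this⟩
  rw [h, Fintype.card_piFinset]
  have h2 : ∀ b : B, (if (b : ℕ) ∈ J then {i} else Finset.univ.erase i : Finset (Fin G)).card =
      (fun b : ℕ => if b ∈ J then 1 else G - 1) b := by
    intro b
    split
    · simp [*]
    · simp [*, Finset.card_erase_of_mem]
  rw [Finset.prod_congr rfl fun b _ => h2 b, Finset.prod_coe_sort B
    (fun b : ℕ => if b ∈ J then 1 else G - 1), Finset.prod_ite, Finset.prod_const_one, one_mul,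
    Finset.prod_const, Finset.sdiff_eq_filter]

lemma sum_digits_eq {B : Finset ℕ} {G : ℕ} (i : Fin G) (f : Finset ℕ → ℕ) :
    ∑ c : B → Fin G, f (digits c i) = ∑ J ∈ B.powerset, (G - 1) ^ (B \ J).card * f J := by
  rw [← Finset.sum_fiberwise_of_maps_to (t := B.powerset) (g := fun c : B → Fin G => digits c i)
    (fun c _ => Finset.mem_powerset.2 (digits_subset c i))]
  refine Finset.sum_congr rfl fun J hJ => ?_
  rw [← card_filter_digits_eq (Finset.mem_powerset.1 hJ) i, ← smul_eq_mul, ← Finset.sum_const]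
  exact Finset.sum_congr rfl fun c hc => by rw [(Finset.mem_filter.1 hc).2]

/-- The sum over the assignments sending both `u` and `w` to the same runner. -/
lemma sum_ite_eq {B : Finset ℕ} {G : ℕ} {u w : ℕ} (hu : u ∈ B) (hw : w ∈ B)
    (f : Finset ℕ → ℕ) :
    ∑ c : B → Fin G, (if c ⟨u, hu⟩ = c ⟨w, hw⟩ then f (digits c (c ⟨u, hu⟩)) else 0) =
      G * ∑ J ∈ B.powerset.filter (fun J => u ∈ J ∧ w ∈ J), (G - 1) ^ (B \ J).card * f J := by
  have h : ∀ c : B → Fin G,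
      (if c ⟨u, hu⟩ = c ⟨w, hw⟩ then f (digits c (c ⟨u, hu⟩)) else 0) =
      ∑ i : Fin G, (fun J => if u ∈ J ∧ w ∈ J then f J else 0) (digits c i) := by
    intro c
    rw [Finset.sum_eq_single (c ⟨u, hu⟩)]
    · refine if_congr ?_ rfl rfl
      rw [mem_digits, mem_digits]
      exact ⟨fun h => ⟨⟨hu, rfl⟩, hw, h.symm⟩, fun h => h.2.2.symm⟩
    · intro i _ hi
      refine if_neg fun h => hi ?_
      obtain ⟨_, h⟩ := mem_digits.1 h.1
      exact h.symm
    · simp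
  rw [Finset.sum_congr rfl fun c _ => h c, Finset.sum_comm,
    Finset.sum_congr rfl fun i _ =>
      sum_digits_eq i (fun J => if u ∈ J ∧ w ∈ J then f J else 0), Finset.sum_const,
    Finset.card_univ,
    Fintype.card_fin, smul_eq_mul]
  congr 1
  rw [Finset.sum_filter]
  exact Finset.sum_congr rfl fun J _ => by split <;> simp

lemma card_filter_ne {B : Finset ℕ} {G : ℕ} {u w : ℕ} (hu : u ∈ B) (hw : w ∈ B) (huw : u ≠ w) :
    (Finset.univ.filter (fun c : B → Fin G => c ⟨u, hu⟩ ≠ c ⟨w, hw⟩)).card =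
      G ^ (B.card - 1) * (G - 1) := by
  have h2B : 2 ≤ B.card := by
    have := Finset.card_le_card (s := {u, w}) (t := B) (by
      intro x; simp only [Finset.mem_insert, Finset.mem_singleton]
      rintro (rfl | rfl) <;> assumption)
    rwa [Finset.card_pair huw] at this
  have h1 : (Finset.univ.filter (fun c : B → Fin G => c ⟨u, hu⟩ = c ⟨w, hw⟩)).card =
      G * G ^ (B.card - 2) := by
    rw [Finset.card_eq_sum_card_fiberwise (t := Finset.univ) (f := fun c => c ⟨u, hu⟩)
      (fun _ _ => Finset.mem_univ _)]
    have hi : ∀ i : Fin G, ((Finset.univ.filter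
        (fun c : B → Fin G => c ⟨u, hu⟩ = c ⟨w, hw⟩)).filter (fun c => c ⟨u, hu⟩ = i)).card =
        G ^ (B.card - 2) := by
      intro i
      have : (Finset.univ.filter
          (fun c : B → Fin G => c ⟨u, hu⟩ = c ⟨w, hw⟩)).filter (fun c => c ⟨u, hu⟩ = i) =
          Fintype.piFinset (fun b : B => if b ∈ ({⟨u, hu⟩, ⟨w, hw⟩} : Finset B) then {i}
            else Finset.univ) := by
        ext c
        simp only [Finset.mem_filter, Finset.mem_univ, true_and, Fintype.mem_piFinset]
        constructor
        · rintro ⟨h1, h2⟩ b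
          split
          · rename_i hb
            rw [Finset.mem_insert, Finset.mem_singleton] at hb
            rw [Finset.mem_singleton]
            rcases hb with rfl | rfl
            · exact h2
            · rw [← h1, h2]
          · exact Finset.mem_univ _
        · intro h
          have h1 := h ⟨u, hu⟩
          have h2 := h ⟨w, hw⟩
          rw [if_pos (by simp), Finset.mem_singleton] at h1 h2
          exact ⟨h1.trans h2.symm, h1⟩
      rw [this, Fintype.card_piFinset]
      have h2 : ∀ b : B, (if b ∈ ({⟨u, hu⟩, ⟨w, hw⟩} : Finset B) then {i}
            else Finset.univ : Finset (Fin G)).card =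
          if b ∈ ({⟨u, hu⟩, ⟨w, hw⟩} : Finset B) then 1 else G := by
        intro b; split <;> simp
      rw [Finset.prod_congr rfl fun b _ => h2 b, Finset.prod_ite, Finset.prod_const_one, one_mul,
        Finset.prod_const]
      congr 1
      have h3 : Finset.univ.filter (fun b : B => b ∉ ({⟨u, hu⟩, ⟨w, hw⟩} : Finset B)) =
          Finset.univ \ {⟨u, hu⟩, ⟨w, hw⟩} := by ext; simp
      rw [h3, Finset.card_sdiff_of_subset (Finset.subset_univ _), Finset.card_univ,
        Fintype.card_coe, Finset.card_pair (by simpa using huw)]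
    rw [Finset.sum_congr rfl fun i _ => hi i]
    simp
  have h3 := Finset.card_filter_add_card_filter_not (s := (Finset.univ : Finset (B → Fin G)))
    (fun c => c ⟨u, hu⟩ = c ⟨w, hw⟩)
  rw [h1, Finset.card_univ, Fintype.card_fun, Fintype.card_coe, Fintype.card_fin] at h3
  obtain ⟨s, hs⟩ : ∃ s, B.card = s + 2 := ⟨B.card - 2, by omega⟩
  rw [hs] at h3 ⊢
  have h4 : G ^ (s + 2 - 1) * (G - 1) = G ^ (s + 2) - G * G ^ (s + 2 - 2) := by
    rw [Nat.mul_sub, mul_one, show s + 2 - 1 = s + 1 by omega, show s + 2 - 2 = s by omega,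
      ← pow_succ, ← pow_succ']
  rw [h4]
  simp only [ne_eq]
  omega

lemma sum_ge_of_mem {J : Finset ℕ} {d u w : ℕ} (hu : u ∈ J) (hw : w ∈ J) (hdw : d ≤ w)
    (h : d < u ∨ u < w) : 2 ^ 0 + 2 ^ d ≤ ∑ b ∈ J, 2 ^ b := by
  have hdw' : 2 ^ d ≤ 2 ^ w := Nat.pow_le_pow_right two_pos hdw
  have h1 : ∀ x, 1 ≤ 2 ^ x := fun x => Nat.one_le_two_pow
  rcases h with h | h
  · have h2 : 2 ^ (d + 1) ≤ 2 ^ u := Nat.pow_le_pow_right two_pos h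
    have h3 := Finset.single_le_sum (f := fun b => 2 ^ b) (fun _ _ => Nat.zero_le _) hu
    have := h1 d
    simp only [pow_succ, pow_zero] at *
    omega
  · have h3 := Finset.sum_le_sum_of_subset (f := fun b => 2 ^ b) (s := {u, w}) (t := J) (by
      intro x; simp only [Finset.mem_insert, Finset.mem_singleton]
      rintro (rfl | rfl) <;> assumption)
    rw [Finset.sum_pair h.ne] at h3
    have := h1 u
    simp only [pow_zero] at *
    omega

/-- The operations `op k` and `op l` do not commute on `X`. -/
def NotComm (k l : ℕ) (X : Finset ℕ) : Prop := op k (op l X) ≠ op l (op k X)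

lemma Fnum_eq_card_notComm {k l n M : ℕ} (h : 2 ^ k + 2 ^ l ≤ n) (hM : n ≤ M) :
    Fnum k l n = ((oddSets M n).filter (NotComm k l)).card := by
  rw [Fnum_eq_card h hM]
  congr 1
  ext X
  simp only [Finset.mem_filter, NotComm]

lemma card_filter_not_comm_run {k m d M u w : ℕ} {B C : Finset ℕ} (hC : C ∈ oddSets M m)
    (hM : m + 2 ^ k * ∑ b ∈ B, 2 ^ b ≤ M) (c : B → Fin (2 ^ k)) (i : Fin (2 ^ k))
    (hu : u ∈ digits c i) (hw : w ∈ digits c i) (hdw : d ≤ w) (h : d < u ∨ u < w) :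
    ((Fintype.piFinset fun i : Fin (2 ^ k) =>
      oddSets (run (2 ^ k) i C).card (∑ b ∈ digits c i, 2 ^ b)).filter
        (fun Y => NotComm 0 d (Y i))).card =
    (∏ b ∈ B \ digits c i, 2 ^ b) * Fnum 0 d (∑ b ∈ digits c i, 2 ^ b) := by
  rw [card_filter_runs hC hM c i (NotComm 0 d),
    Fnum_eq_card_notComm (sum_ge_of_mem hu hw hdw h)
      ((sum_digits_le c i).trans (le_card_run hC hM i)),
    mul_comm]

lemma card_not_comm_of_ne {k m d M u w : ℕ} {B : Finset ℕ} (hm : m < 2 ^ k)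
    (hM : m + 2 ^ k * ∑ b ∈ B, 2 ^ b ≤ M)
    (hu : u ∈ B) (humin : ∀ b ∈ B, u ≤ b) (hw : w ∈ B) (hdw : d ≤ w)
    (hwmin : ∀ b ∈ B, d ≤ b → w ≤ b) (hud : u ≠ d) :
    ((oddSets M (m + 2 ^ k * ∑ b ∈ B, 2 ^ b)).filter
      (NotComm k (k + d))).card =
    (oddSets M m).card * (2 ^ k * ∑ J ∈ B.powerset.filter (fun J => u ∈ J ∧ w ∈ J),
      (2 ^ k - 1) ^ (B \ J).card * ((∏ b ∈ B \ J, 2 ^ b) * Fnum 0 d (∑ b ∈ J, 2 ^ b))) := by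
  have hud' : d < u ∨ u < w := by
    have := humin w hw
    omega
  rw [card_filter_oddSets hm, ← sum_ite_eq hu hw, ← smul_eq_mul, ← Finset.sum_const]
  refine Finset.sum_congr rfl fun C hC => Finset.sum_congr rfl fun c _ => ?_
  have key : ∀ Y ∈ Fintype.piFinset fun i : Fin (2 ^ k) =>
      oddSets (run (2 ^ k) i C).card (∑ b ∈ digits c i, 2 ^ b),
      (NotComm k (k + d) (ofFinRuns Y) ↔
      c ⟨u, hu⟩ = c ⟨w, hw⟩ ∧ NotComm 0 d (Y (c ⟨u, hu⟩))) := by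
    intro Y hY
    obtain ⟨h1, -, h3⟩ := ofFinRuns_spec hm hC (fun i => Fintype.mem_piFinset.1 hY i)
    obtain ⟨-, hs, ho⟩ := mem_oddSets.1 h1
    rw [NotComm, NotComm, ho.op_comm_iff hm hs h3 hu humin hw hdw hwmin hud, extend_apply hu,
      extend_apply hw,
      run_ofFinRuns, Fin.ext_iff]
  rw [Finset.filter_congr key]
  split
  · rename_i h
    simp only [h, true_and]
    refine card_filter_not_comm_run hC hM c _ (mem_digits.2 ⟨hu, h⟩) (mem_digits.2 ⟨hw, rfl⟩)
      hdw hud'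
  · rename_i h
    simp [h]

lemma card_not_comm_of_eq {k m d M w : ℕ} {B : Finset ℕ} (hm : m < 2 ^ k)
    (hM : m + 2 ^ k * ∑ b ∈ B, 2 ^ b ≤ M) (hd0 : 0 < d)
    (hd : d ∈ B) (hdmin : ∀ b ∈ B, d ≤ b) (hw : w ∈ B) (hdw : d < w)
    (hwmin : ∀ b ∈ B, d < b → w ≤ b) :
    ((oddSets M (m + 2 ^ k * ∑ b ∈ B, 2 ^ b)).filter
      (NotComm k (k + d))).card =
    (oddSets M m).card * (2 ^ k * ∑ J ∈ B.powerset.filter (fun J => d ∈ J ∧ w ∈ J),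
      (2 ^ k - 1) ^ (B \ J).card * ((∏ b ∈ B \ J, 2 ^ b) * Fnum 0 d (∑ b ∈ J, 2 ^ b)) +
      (2 ^ k) ^ (B.card - 1) * (2 ^ k - 1) * ∏ b ∈ B, 2 ^ b) := by
  rw [card_filter_oddSets hm, ← sum_ite_eq hd hw, ← card_filter_ne hd hw hdw.ne,
    ← smul_eq_mul (Finset.card (Finset.filter _ _)), ← Finset.sum_const, Finset.sum_filter,
    ← Finset.sum_add_distrib, ← smul_eq_mul, ← Finset.sum_const]
  refine Finset.sum_congr rfl fun C hC => Finset.sum_congr rfl fun c _ => ?_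
  have key : ∀ Y ∈ Fintype.piFinset fun i : Fin (2 ^ k) =>
      oddSets (run (2 ^ k) i C).card (∑ b ∈ digits c i, 2 ^ b),
      (NotComm k (k + d) (ofFinRuns Y) ↔
      c ⟨d, hd⟩ ≠ c ⟨w, hw⟩ ∨ NotComm 0 d (Y (c ⟨d, hd⟩))) := by
    intro Y hY
    obtain ⟨h1, -, h3⟩ := ofFinRuns_spec hm hC (fun i => Fintype.mem_piFinset.1 hY i)
    obtain ⟨-, hs, ho⟩ := mem_oddSets.1 h1
    rw [NotComm, NotComm, ho.op_comm_iff' hm hs h3 hd0 hd hdmin hw hdw hwmin, extend_apply hd,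
      extend_apply hw,
      run_ofFinRuns, ne_eq, ne_eq (c _), Fin.ext_iff]
  rw [Finset.filter_congr key]
  by_cases h : c ⟨d, hd⟩ = c ⟨w, hw⟩
  · simp only [h, ne_eq, not_true_eq_false, false_or, if_true, if_false, add_zero]
    exact card_filter_not_comm_run hC hM c _ (mem_digits.2 ⟨hd, h⟩) (mem_digits.2 ⟨hw, rfl⟩)
      hdw.le (Or.inr hdw)
  · simp only [h, ne_eq, not_false_eq_true, true_or, if_true, if_false, zero_add,
      Finset.filter_true]
    exact card_runs hC hM c

lemma sum_powerset_image {I : Finset ℕ} {g : ℕ → ℕ} (hg : Set.InjOn g I) {x y : ℕ} (hx : x ∈ I)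
    (hy : y ∈ I) (e : ℕ) (F : ℕ → ℕ) :
    ∑ J ∈ (I.image g).powerset.filter (fun J => g x ∈ J ∧ g y ∈ J),
      e ^ (I.image g \ J).card * ((∏ b ∈ I.image g \ J, 2 ^ b) * F (∑ b ∈ J, 2 ^ b)) =
    ∑ J ∈ I.powerset.filter (fun J => x ∈ J ∧ y ∈ J),
      (∏ i ∈ I \ J, 2 ^ g i) * e ^ (I \ J).card * F (∑ j ∈ J, 2 ^ g j) := by
  have hmem : ∀ J ⊆ I, ∀ z ∈ I, (g z ∈ J.image g ↔ z ∈ J) := fun J hJ z hz =>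
    ⟨fun h => by
      obtain ⟨z', hz', h⟩ := Finset.mem_image.1 h
      rwa [← hg (hJ hz') hz h], Finset.mem_image_of_mem g⟩
  symm
  refine Finset.sum_bij (fun J _ => J.image g) (fun J hJ => ?_) (fun J hJ J' hJ' h => ?_)
    (fun K hK => ?_) (fun J hJ => ?_)
  · obtain ⟨h1, h2, h3⟩ := Finset.mem_filter.1 hJ
    exact Finset.mem_filter.2 ⟨Finset.mem_powerset.2
      (Finset.image_subset_image (Finset.mem_powerset.1 h1)), Finset.mem_image_of_mem g h2,
      Finset.mem_image_of_mem g h3⟩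
  · have h1 := Finset.mem_powerset.1 (Finset.mem_filter.1 hJ).1
    have h2 := Finset.mem_powerset.1 (Finset.mem_filter.1 hJ').1
    ext z
    constructor
    · intro hz
      rw [← hmem J' h2 z (h1 hz), ← h]
      exact Finset.mem_image_of_mem g hz
    · intro hz
      rw [← hmem J h1 z (h2 hz), h]
      exact Finset.mem_image_of_mem g hz
  · obtain ⟨h1, h2, h3⟩ := Finset.mem_filter.1 hK
    have hK' : (I.filter (fun z => g z ∈ K)).image g = K := by
      ext b
      simp only [Finset.mem_image, Finset.mem_filter]
      constructor
      · rintro ⟨z, ⟨_, hz⟩, rfl⟩; exact hz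
      · intro hb
        obtain ⟨z, hz, rfl⟩ := Finset.mem_image.1 (Finset.mem_powerset.1 h1 hb)
        exact ⟨z, ⟨hz, hb⟩, rfl⟩
    exact ⟨I.filter (fun z => g z ∈ K), Finset.mem_filter.2 ⟨Finset.mem_powerset.2
      (Finset.filter_subset _ _), Finset.mem_filter.2 ⟨hx, h2⟩, Finset.mem_filter.2 ⟨hy, h3⟩⟩, hK'⟩
  · have h1 := Finset.mem_powerset.1 (Finset.mem_filter.1 hJ).1
    have h2 : I.image g \ J.image g = (I \ J).image g := by
      ext b
      simp only [Finset.mem_sdiff, Finset.mem_image]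
      constructor
      · rintro ⟨⟨z, hz, rfl⟩, h⟩
        exact ⟨z, ⟨hz, fun hzJ => h ⟨z, hzJ, rfl⟩⟩, rfl⟩
      · rintro ⟨z, ⟨hz, hzJ⟩, rfl⟩
        exact ⟨⟨z, hz, rfl⟩, fun ⟨z', hz', h⟩ => hzJ (hg (h1 hz') hz h ▸ hz')⟩
    have h3 : Set.InjOn g (I \ J : Finset ℕ) := hg.mono (by simp)
    have h4 : Set.InjOn g J := hg.mono (by simpa using h1)
    rw [h2, Finset.card_image_of_injOn h3, Finset.prod_image h3, Finset.sum_image h4]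
    ring

lemma sum_two_pow_lt {S : Finset ℕ} {a : ℕ → ℕ} (ha : Set.InjOn a S) {k : ℕ}
    (h : ∀ i ∈ S, a i < k) : ∑ i ∈ S, 2 ^ a i < 2 ^ k := by
  rw [← Finset.sum_image (f := fun b => 2 ^ b) ha]
  exact Nat.geomSum_lt le_rfl fun b hb => by
    obtain ⟨i, hi, rfl⟩ := Finset.mem_image.1 hb
    exact h i hi

theorem stmt18 (n t m k l : ℕ) (hn6 : 6 < n) (hnm : n = 2 ^ t + m) (hm : m < 2 ^ t)
    (hkl : k < l) (hlt : l < t) (hkm : 2 ^ k ≤ m)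
    (r : ℕ) (a : ℕ → ℕ)
    (hdec : ∀ i j, 1 ≤ i → i < j → j ≤ r → a j < a i)
    (hexp : n = ∑ i ∈ Finset.Icc 1 r, 2 ^ a i)
    (p q : ℕ) (hp : p ∈ Finset.Icc 1 r) (hap : l ≤ a p)
    (hpmax : ∀ i ∈ Finset.Icc 1 r, l ≤ a i → i ≤ p)
    (hq : q ∈ Finset.Icc 1 r) (haq : k ≤ a q)
    (hqmax : ∀ i ∈ Finset.Icc 1 r, k ≤ a i → i ≤ q) :
    ((a q < a p ∨ (a p = a q ∧ l < a p)) →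
      Fnum k l n = (∏ j ∈ Finset.Icc (q + 1) r, 2 ^ a j) * 2 ^ k *
        ∑ J ∈ (Finset.Icc 1 q).powerset.filter (fun J => p ∈ J ∧ q ∈ J),
          (∏ i ∈ Finset.Icc 1 q \ J, 2 ^ (a i - k)) *
            (2 ^ k - 1) ^ (Finset.Icc 1 q \ J).card *
            Fnum 0 (l - k) (∑ j ∈ J, 2 ^ (a j - k))) ∧
    (a p = a q ∧ a p = l →
      Fnum k l n = (∏ j ∈ Finset.Icc (q + 1) r, 2 ^ a j) *
        (2 ^ k * (∑ J ∈ (Finset.Icc 1 q).powerset.filter (fun J => p - 1 ∈ J ∧ p ∈ J),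
            (∏ i ∈ Finset.Icc 1 q \ J, 2 ^ (a i - k)) *
              (2 ^ k - 1) ^ (Finset.Icc 1 q \ J).card *
              Fnum 0 (l - k) (∑ j ∈ J, 2 ^ (a j - k)))
          + 2 ^ (k * (q - 1)) * (2 ^ k - 1) * ∏ i ∈ Finset.Icc 1 q, 2 ^ (a i - k))) := by
  obtain ⟨d, rfl⟩ : ∃ d, l = k + d := ⟨l - k, by omega⟩
  rw [Nat.add_sub_cancel_left]
  have hp' := Finset.mem_Icc.1 hp
  have hq' := Finset.mem_Icc.1 hq
  have hpq : p ≤ q := hqmax p hp (by omega)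
  have hanti : ∀ i j, 1 ≤ i → i ≤ j → j ≤ r → a j ≤ a i := fun i j h1 h2 h3 => by
    rcases h2.eq_or_lt with rfl | h2
    · exact le_rfl
    · exact (hdec i j h1 h2 h3).le
  have hinj : Set.InjOn a (Finset.Icc 1 r) := by
    intro i hi j hj h
    simp only [Finset.coe_Icc, Set.mem_Icc] at hi hj
    rcases lt_trichotomy i j with h' | h' | h'
    · exact absurd h (hdec i j hi.1 h' hj.2).ne'
    · exact h'
    · exact absurd h (hdec j i hj.1 h' hi.2).ne
  have hak : ∀ i ∈ Finset.Icc 1 q, k ≤ a i := fun i hi => by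
    have hi := Finset.mem_Icc.1 hi
    exact haq.trans (hanti i q hi.1 hi.2 hq'.2)
  have hg : Set.InjOn (fun i => a i - k) (Finset.Icc 1 q) := by
    intro i hi j hj h
    have h1 := hak i hi
    have h2 := hak j hj
    simp only [Finset.coe_Icc, Set.mem_Icc] at hi hj h
    exact hinj (by simp; omega) (by simp; omega) (by omega)
  have hinj' : Set.InjOn a (Finset.Icc (q + 1) r) := hinj.mono (by
    intro i; simp only [Finset.coe_Icc, Set.mem_Icc]; omega)
  set B := (Finset.Icc 1 q).image (fun i => a i - k) with hB
  have hmB : ∀ i, 1 ≤ i → i ≤ q → a i - k ∈ B := fun i h1 h2 =>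
    Finset.mem_image_of_mem (fun i => a i - k) (Finset.mem_Icc.2 ⟨h1, h2⟩)
  have hBall : ∀ P : ℕ → Prop, (∀ i, 1 ≤ i → i ≤ q → k ≤ a i → P (a i - k)) → ∀ b ∈ B, P b := by
    intro P hP b hb
    obtain ⟨i, hi, rfl⟩ := Finset.mem_image.1 hb
    exact hP i (Finset.mem_Icc.1 hi).1 (Finset.mem_Icc.1 hi).2 (hak i hi)
  have hBcard : B.card = q := by rw [Finset.card_image_of_injOn hg]; simp
  set μ := ∑ j ∈ Finset.Icc (q + 1) r, 2 ^ a j with hμ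
  have hμk : μ < 2 ^ k := by
    refine sum_two_pow_lt hinj' fun i hi => ?_
    by_contra hcon
    have hi := Finset.mem_Icc.1 hi
    have := hqmax i (Finset.mem_Icc.2 ⟨by omega, hi.2⟩) (by omega)
    omega
  have hn : n = μ + 2 ^ k * ∑ b ∈ B, 2 ^ b := by
    rw [hB, Finset.sum_image hg, Finset.mul_sum,
      Finset.sum_congr rfl fun i hi => by
        rw [← pow_add, Nat.add_sub_cancel' (hak i hi)], hexp, hμ, add_comm,
      ← Finset.sum_union]
    · congr 1
      ext i
      simp only [Finset.mem_Icc, Finset.mem_union]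
      omega
    · refine Finset.disjoint_left.2 fun i => ?_
      simp only [Finset.mem_Icc]
      omega
  have hμcard : (oddSets n μ).card = ∏ j ∈ Finset.Icc (q + 1) r, 2 ^ a j := by
    rw [← Finset.prod_image (f := fun b => 2 ^ b) hinj', ← card_oddSets (M := n)]
    · rw [Finset.sum_image hinj']
    · rw [Finset.sum_image hinj']; omega
  have hFn : Fnum k (k + d) n =
      ((oddSets n (μ + 2 ^ k * ∑ b ∈ B, 2 ^ b)).filter (NotComm k (k + d))).card := by
    rw [← hn]
    refine Fnum_eq_card_notComm ?_ le_rfl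
    have : 2 ^ (k + d) ≤ 2 ^ t := Nat.pow_le_pow_right two_pos hlt.le
    omega
  have humin : ∀ b ∈ B, a q - k ≤ b := hBall _ fun i h1 h2 _ => by
    have := hanti i q h1 h2 hq'.2
    omega
  constructor
  · intro h
    have hud : a q - k ≠ d := by
      rcases h with h | h
      · have : p ≠ q := by rintro rfl; omega
        have : ¬ (k + d ≤ a q) := fun h' => by
          have := hpmax q hq h'
          omega
        omega
      · omega
    rw [hFn, card_not_comm_of_ne hμk hn.ge (hmB q hq'.1 le_rfl) humin (hmB p hp'.1 hpq) (by omega)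
      (hBall _ fun i h1 h2 h3 h4 => by
        have := hpmax i (Finset.mem_Icc.2 ⟨h1, by omega⟩) (by omega)
        have := hanti i p h1 this hp'.2
        omega) hud, hμcard, mul_assoc, hB,
      sum_powerset_image hg (Finset.mem_Icc.2 ⟨hq'.1, le_rfl⟩) (Finset.mem_Icc.2 ⟨hp'.1, hpq⟩)]
    simp only [and_comm]
  · rintro ⟨h1, h2⟩
    have hpq' : p = q := hinj hp hq h1
    subst hpq'
    have hp2 : 2 ≤ p := by
      by_contra hcon
      have hp1 : p = 1 := by omega
      subst hp1
      have h3 : ∑ i ∈ Finset.Icc 1 r, 2 ^ a i < 2 ^ (k + d + 1) :=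
        sum_two_pow_lt hinj fun i hi => by
          have hi := Finset.mem_Icc.1 hi
          have := hanti 1 i le_rfl hi.1 hi.2
          omega
      have h4 : 2 ^ (k + d + 1) ≤ 2 ^ t := Nat.pow_le_pow_right two_pos hlt
      omega
    have hd : a p - k = d := by omega
    have hlt' := hdec (p - 1) p (by omega) (by omega) hp'.2
    rw [hFn, card_not_comm_of_eq hμk hn.ge (by omega) (hd ▸ hmB p hp'.1 le_rfl) (hd ▸ humin)
      (hmB (p - 1) (by omega) (by omega)) (by omega)
      (hBall _ fun i h1 h2 h3 h4 => by
        have : i ≠ p := by rintro rfl; omega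
        have := hanti i (p - 1) h1 (by omega) (by omega)
        omega), hμcard, hBcard, ← pow_mul, hB, Finset.prod_image hg]
    have := sum_powerset_image hg (Finset.mem_Icc.2 ⟨hp'.1, le_rfl⟩)
      (Finset.mem_Icc.2 (⟨by omega, by omega⟩ : 1 ≤ p - 1 ∧ p - 1 ≤ p)) (2 ^ k - 1) (Fnum 0 d)
    simp only [hd] at this
    rw [this]
    simp only [and_comm]

end OddSym
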